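/- Let k ≥ 2, s, s₁,…,s_k ∈ ℝ, and let M : ℝ^k → [0,∞) be a measurable multiplier of polynomial growth. Suppose there exist a nonempty proper subset A of {0,1,…,k}, measurable M₁, M₂ : ℝ^k → [0,∞), C₀ > 0 and θ ∈ (0,1) such that (M₁M₂)^{1/2} = M · ⟨ξ⟩^{s} / ∏_{j=1}^k ⟨ξ_j⟩^{s_j} pointwise (ξ = ξ₁+⋯+ξ_k identified with ξ₀), and for all K > 0: S_A(M₁,K) + S_{Aᶜ}(M₂,K) ≤ C₀ K^{θ}, where S_B(M′,K) is the supremum over α ∈ ℝ and fixed ξ_j, j ∉ B, of the integral of M′ · 1_{|Φ−α| < K} over the variables ξ_j, j ∈ B, constrained to ξ₀ = ξ₁+⋯+ξ_k, and Φ = ξ₀³ − ξ₁³ − ⋯ − ξ_k³. Then there exist b ∈ (1/2,1), b′ ∈ (b−1,0), ε > 0 and C > 0 such that for every K > 0 and all Schwartz functions v₁,…,v_k on ℝ²: ‖( (M/|Φ|)·1_{|Φ| > K} )^∨(v₁,…,v_k)‖_{X^{s,b′}} ≤ C K^{−ε} ‖v₁‖_{X^{s₁,b′}} ∏_{j=2}^k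 ‖v_j‖_{X^{s_j,b}}. -/

import Mathlib

open MeasureTheory

noncomputable section

/-- Spacetime Fourier transform on ℝ². -/
def FT2 (u : ℝ × ℝ → ℂ) (τ ξ : ℝ) : ℂ :=
  ∫ p : ℝ × ℝ, Complex.exp (-(Complex.I * ((p.1 * τ + p.2 * ξ : ℝ) : ℂ))) * u p

/-- Bourgain weight ⟨ξ⟩^{2s}⟨τ-ξ³⟩^{2b}, with ⟨x⟩ = (1+x²)^{1/2}. -/
def wgt (s b τ ξ : ℝ) : ℝ := (1 + ξ ^ 2) ^ s * (1 + (τ - ξ ^ 3) ^ 2) ^ b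

/-- The Bourgain norm ‖u‖_{X^{s,b}}. -/
def Xnorm (s b : ℝ) (u : ℝ × ℝ → ℂ) : ℝ :=
  Real.sqrt (∫ q : ℝ × ℝ, wgt s b q.1 q.2 * ‖FT2 u q.1 q.2‖ ^ 2)

/-- Extend `k-1` frequencies to `k` with the last determined by the total `tot`. -/
def padTot (k : ℕ) (tot : ℝ) (v : Fin (k - 1) → ℝ) : Fin k → ℝ :=
  fun j => if h : (j : ℕ) < k - 1 then v ⟨j, h⟩ else tot - ∑ i, v i

/-- Spacetime Fourier transform of M^∨(u₁,…,u_k) at (τ,ξ). -/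
def convFT (k : ℕ) (M : (Fin k → ℝ) → ℂ) (u : Fin k → ℝ × ℝ → ℂ) (τ ξ : ℝ) : ℂ :=
  ∫ q : Fin (k - 1) → ℝ × ℝ,
    M (padTot k ξ fun i => (q i).2) *
      ∏ j, FT2 (u j) (padTot k τ (fun i => (q i).1) j) (padTot k ξ (fun i => (q i).2) j)

/-- The Bourgain norm ‖M^∨(u₁,…,u_k)‖_{X^{s,b}}. -/
def XnormM (s b : ℝ) (k : ℕ) (M : (Fin k → ℝ) → ℂ) (u : Fin k → ℝ × ℝ → ℂ) : ℝ :=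
  Real.sqrt (∫ q : ℝ × ℝ, wgt s b q.1 q.2 * ‖convFT k M u q.1 q.2‖ ^ 2)

/-- The variables (ξ₁,…,ξ_k) of a full vector (ξ₀,ξ₁,…,ξ_k). -/
def tailVec (k : ℕ) (η : Fin (k + 1) → ℝ) : Fin k → ℝ := fun i => η i.succ

/-- The resonance function Φ = ξ₀³ − ξ₁³ − ⋯ − ξ_k³. -/
def PhiFull (k : ℕ) (η : Fin (k + 1) → ℝ) : ℝ := (η 0) ^ 3 - ∑ i : Fin k, (η i.succ) ^ 3

/-- Replace the `j₀` coordinate of `v` so that the constraint ξ₀ = ξ₁+⋯+ξ_k holds. -/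
def completeAt (k : ℕ) (j₀ : Fin (k + 1)) (v : Fin (k + 1) → ℝ) : Fin (k + 1) → ℝ :=
  Function.update v j₀
    (if j₀ = 0 then ∑ i : Fin k, v i.succ
     else v 0 - ∑ i : Fin k, if i.succ = j₀ then 0 else v i.succ)

/-- Build the full frequency vector: coordinates outside `B` are fixed by `g`, the
coordinates in `B` other than `j₀` are the free variables `h`, and the `j₀` coordinate is
determined by the hyperplane constraint ξ₀ = ξ₁+⋯+ξ_k. -/
def buildVec (k : ℕ) (B : Finset (Fin (k + 1))) (j₀ : Fin (k + 1))
    (g : Fin (k + 1) → ℝ) (h : {j // j ∈ B.erase j₀} → ℝ) : Fin (k + 1) → ℝ :=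
  completeAt k j₀ (fun j => if hj : j ∈ B.erase j₀ then h ⟨j, hj⟩ else g j)

/-- The frequency-restricted bound S_B(M',K) ≤ C₀ K^θ: for every K > 0, α ∈ ℝ, every
parametrization of the constrained set and all fixed outside variables, the affine integral
of M'·1_{|Φ−α|<K} over the variables in `B` is at most C₀ K^θ. -/
def FreqRestricted (k : ℕ) (M' : (Fin k → ℝ) → ℝ) (B : Finset (Fin (k + 1)))
    (C₀ θ : ℝ) : Prop :=
  ∀ K : ℝ, 0 < K → ∀ α : ℝ, ∀ j₀ ∈ B, ∀ g : Fin (k + 1) → ℝ,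
    (∫⁻ h : {j // j ∈ B.erase j₀} → ℝ,
        ENNReal.ofReal (M' (tailVec k (buildVec k B j₀ g h)) *
          (if |PhiFull k (buildVec k B j₀ g h) - α| < K then 1 else 0)))
      ≤ ENNReal.ofReal (C₀ * K ^ θ)

/-- The resonance function in the free variables: Φ = (ξ₁+⋯+ξ_k)³ − ξ₁³ − ⋯ − ξ_k³. -/
def PhiK (k : ℕ) (ξ : Fin k → ℝ) : ℝ := (∑ j, ξ j) ^ 3 - ∑ j, (ξ j) ^ 3
/-- The space–time Fourier transform of a Schwartz function is a Schwartz function. -/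
theorem exists_schwartz_FT2 (u : SchwartzMap (ℝ × ℝ) ℂ) :
    ∃ G : SchwartzMap (ℝ × ℝ) ℂ, ∀ τ ξ, FT2 u τ ξ = G (τ, ξ) := by
  let e := WithLp.prodContinuousLinearEquiv 2 ℝ ℝ ℝ
  let u' : SchwartzMap (WithLp 2 (ℝ × ℝ)) ℂ := SchwartzMap.compCLMOfContinuousLinearEquiv ℝ e u
  let d : (ℝ × ℝ) ≃L[ℝ] (ℝ × ℝ) :=
    ContinuousLinearEquiv.smulLeft (Units.mk0 ((2 * Real.pi)⁻¹ : ℝ) (by positivity))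
  refine ⟨SchwartzMap.compCLMOfContinuousLinearEquiv ℝ (d.trans e.symm)
    (FourierTransform.fourier u'), fun τ ξ => ?_⟩
  have h1 : ∀ w, (FourierTransform.fourier u' : SchwartzMap (WithLp 2 (ℝ × ℝ)) ℂ) w
      = FourierTransform.fourier (u' : WithLp 2 (ℝ × ℝ) → ℂ) w := fun w => by
    rw [SchwartzMap.fourier_coe]
  simp only [SchwartzMap.compCLMOfContinuousLinearEquiv_apply, Function.comp_apply, h1]
  rw [Real.fourier_eq']
  have mp := WithLp.volume_preserving_symm_measurableEquiv_toLp_prod ℝ ℝ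
  rw [← mp.symm.integral_comp (MeasurableEquiv.measurableEmbedding _)]
  unfold FT2
  congr 1
  ext p
  have hw : (d.trans e.symm) (τ, ξ) =
      WithLp.toLp 2 ((2 * Real.pi)⁻¹ * τ, (2 * Real.pi)⁻¹ * ξ) := rfl
  have hp : (MeasurableEquiv.toLp 2 (ℝ × ℝ)).symm.symm p = WithLp.toLp 2 p := rfl
  have hu : u' (WithLp.toLp 2 p) = u p := rfl
  rw [hw, hp, hu, smul_eq_mul]
  congr 2
  simp only [WithLp.prod_inner_apply, RCLike.inner_apply, conj_trivial]
  push_cast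
  have : (Real.pi : ℂ) ≠ 0 := by exact_mod_cast Real.pi_ne_zero
  field_simp

theorem continuous_FT2 (u : SchwartzMap (ℝ × ℝ) ℂ) :
    Continuous fun q : ℝ × ℝ => FT2 u q.1 q.2 := by
  obtain ⟨G, hG⟩ := exists_schwartz_FT2 u
  simpa only [hG] using G.continuous

theorem rpow_le_pow_of_le {x y : ℝ} (hx : 1 ≤ x) (hxy : x ≤ y) {a : ℝ} {n : ℕ} (han : a ≤ n) :
    x ^ a ≤ y ^ n := by
  calc x ^ a ≤ x ^ (n : ℝ) := Real.rpow_le_rpow_of_exponent_le hx han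
    _ = x ^ n := Real.rpow_natCast _ _
    _ ≤ y ^ n := by gcongr

theorem continuous_wgt (s b : ℝ) : Continuous fun q : ℝ × ℝ => wgt s b q.1 q.2 := by
  unfold wgt
  refine Continuous.mul (Continuous.rpow_const (by fun_prop) fun q => Or.inl ?_)
    (Continuous.rpow_const (by fun_prop) fun q => Or.inl ?_) <;> positivity

theorem wgt_nonneg (s b τ ξ : ℝ) : 0 ≤ wgt s b τ ξ := by unfold wgt; positivity

theorem exists_wgt_le (s b : ℝ) : ∃ N : ℕ, ∀ q : ℝ × ℝ, wgt s b q.1 q.2 ≤ (1 + ‖q‖) ^ N := by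
  obtain ⟨m, hm⟩ := exists_nat_ge s
  obtain ⟨n, hn⟩ := exists_nat_ge b
  refine ⟨2 * m + 6 * n, fun q => ?_⟩
  have h1 : |q.1| ≤ ‖q‖ := norm_fst_le q
  have h2 : |q.2| ≤ ‖q‖ := norm_snd_le q
  set r := ‖q‖
  have hr : 0 ≤ r := (abs_nonneg _).trans h1
  have h3 : q.2 ^ 2 ≤ r ^ 2 := sq_le_sq' (by linarith [neg_abs_le q.2]) (by linarith [le_abs_self q.2])
  have h4 : |q.1 - q.2 ^ 3| ≤ r + r ^ 3 := by
    calc |q.1 - q.2 ^ 3| ≤ |q.1| + |q.2 ^ 3| := abs_sub _ _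
      _ ≤ r + r ^ 3 := by rw [abs_pow]; gcongr
  have h5 : (q.1 - q.2 ^ 3) ^ 2 ≤ (r + r ^ 3) ^ 2 := by
    rw [← sq_abs]; gcongr
  rw [pow_add, pow_mul, pow_mul]
  unfold wgt
  gcongr
  · exact rpow_le_pow_of_le (by nlinarith [sq_nonneg q.2]) (by nlinarith) hm
  · refine rpow_le_pow_of_le (by nlinarith [sq_nonneg (q.1 - q.2 ^ 3)]) ?_ hn
    have : (1 + r) ^ 6 - (1 + (r + r ^ 3) ^ 2) = 6 * r + 14 * r ^ 2 + 20 * r ^ 3 + 13 * r ^ 4 +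
      6 * r ^ 5 := by ring
    nlinarith [show 0 ≤ 6 * r + 14 * r ^ 2 + 20 * r ^ 3 + 13 * r ^ 4 + 6 * r ^ 5 by positivity]

theorem integrable_wgt_mul_FT2 (s b : ℝ) (u : SchwartzMap (ℝ × ℝ) ℂ) :
    Integrable fun q : ℝ × ℝ => wgt s b q.1 q.2 * ‖FT2 u q.1 q.2‖ ^ 2 := by
  obtain ⟨G, hG⟩ := exists_schwartz_FT2 u
  obtain ⟨N, hN⟩ := exists_wgt_le s b
  obtain ⟨C, hC0, hC⟩ := G.decay 0 0
  simp only [pow_zero, one_mul, norm_iteratedFDeriv_zero] at hC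
  have hI : Integrable fun q : ℝ × ℝ => 2 ^ (N - 1) * (‖G q‖ + ‖q‖ ^ N * ‖G q‖) * C :=
    ((G.integrable.norm.add (G.integrable_pow_mul volume N)).const_mul _).mul_const _
  refine hI.mono' ?_ (Filter.Eventually.of_forall fun q => ?_)
  · exact ((continuous_wgt s b).mul ((continuous_FT2 u).norm.pow 2)).aestronglyMeasurable
  · rw [Real.norm_of_nonneg (mul_nonneg (wgt_nonneg _ _ _ _) (by positivity)), hG]
    calc wgt s b q.1 q.2 * ‖G (q.1, q.2)‖ ^ 2
        ≤ (2 ^ (N - 1) * (1 ^ N + ‖q‖ ^ N)) * (‖G q‖ * C) := by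
          rw [sq]
          gcongr
          · exact (hN q).trans (add_pow_le zero_le_one (norm_nonneg q) N)
          · exact hC q
      _ = _ := by ring

theorem measurable_completeAt (k : ℕ) (j₀ : Fin (k + 1)) : Measurable (completeAt k j₀) := by
  unfold completeAt
  refine measurable_pi_lambda _ fun j => ?_
  by_cases hj : j = j₀
  · subst hj
    simp only [Function.update_self]
    split_ifs
    · fun_prop
    · refine (measurable_pi_apply _).sub (Finset.measurable_sum _ fun i _ => ?_)
      split_ifs <;> fun_prop
  · simp only [Function.update_of_ne hj]
    fun_prop

theorem completeAt_zero (k : ℕ) (v : Fin (k + 1) → ℝ) :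
    completeAt k 0 v = Fin.cons (∑ i : Fin k, v i.succ) (fun i => v i.succ) := by
  ext j
  refine Fin.cases ?_ (fun i => ?_) j
  · simp [completeAt]
  · simp [completeAt]

theorem completeAt_succ_update (k : ℕ) (m : Fin k) (x : Fin (k + 1) → ℝ) (t : ℝ) :
    completeAt k m.succ
        (Function.update x 0 (t + ∑ i : Fin k, if i = m then 0 else x i.succ)) =
      completeAt k 0 (Function.update x m.succ t) := by
  have hm : m.succ ≠ 0 := Fin.succ_ne_zero m
  rw [completeAt_zero]
  ext j
  refine Fin.cases ?_ (fun i => ?_) j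
  · simp only [completeAt, Function.update_of_ne hm.symm, Function.update_self, Fin.cons_zero]
    rw [← Finset.add_sum_erase _ _ (Finset.mem_univ m),
      ← Finset.add_sum_erase (a := m) Finset.univ (fun i => Function.update x m.succ t i.succ)
        (Finset.mem_univ m)]
    simp only [if_true, Function.update_self, zero_add]
    congr 1
    refine Finset.sum_congr rfl fun i hi => ?_
    have := Finset.ne_of_mem_erase hi
    rw [if_neg this, Function.update_of_ne (by simpa using this)]
  · simp only [completeAt, Fin.cons_succ, if_neg hm, Fin.succ_inj, Function.update_self,
      Function.update_of_ne (Fin.succ_ne_zero _)]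
    by_cases hi : i = m
    · subst hi
      simp
    · simp [Function.update_of_ne, hi]

/-- The integral over the hyperplane `ξ₀ = ξ₁ + ⋯ + ξ_k` does not depend on which variable
is eliminated. -/
theorem lmarginal_completeAt (k : ℕ) (F : (Fin (k + 1) → ℝ) → ENNReal) (hF : Measurable F)
    (j₀ : Fin (k + 1)) (x : Fin (k + 1) → ℝ) :
    lmarginal (fun _ => volume) (Finset.univ.erase j₀) (F ∘ completeAt k j₀) x =
      ∫⁻ ξ : Fin k → ℝ, F (Fin.cons (∑ i, ξ i) ξ) := by
  have base : lmarginal (fun _ => volume) (Finset.univ.erase 0) (F ∘ completeAt k 0) x =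
      ∫⁻ ξ : Fin k → ℝ, F (Fin.cons (∑ i, ξ i) ξ) := by
    have h1 : (Finset.univ.erase 0 : Finset (Fin (k + 1))) = Finset.univ.image Fin.succ := by
      ext j
      refine Fin.cases ?_ (fun i => ?_) j <;> simp
    have hf : Measurable fun ξ : Fin k → ℝ => F (Fin.cons (∑ i, ξ i) ξ) := by
      refine hF.comp (measurable_pi_lambda _ fun j => ?_)
      refine Fin.cases ?_ (fun i => ?_) j
      · simp only [Fin.cons_zero]; fun_prop
      · simp only [Fin.cons_succ]; fun_prop
    have h2 := lmarginal_image (μ := fun _ : Fin (k + 1) => (volume : Measure ℝ))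
      (Fin.succ_injective k) Finset.univ hf x
    rw [lmarginal_univ] at h2
    rw [h1]
    refine Eq.trans ?_ h2
    congr 1
    ext v
    simp only [Function.comp_apply, completeAt_zero]
  refine Fin.cases base (fun m => ?_) j₀
  rw [← base]
  have hm : m.succ ≠ 0 := Fin.succ_ne_zero m
  have e1 : (Finset.univ.erase m.succ : Finset (Fin (k + 1))) =
      insert 0 ((Finset.univ.erase 0).erase m.succ) := by
    ext j; by_cases j = 0 <;> simp_all [hm.symm]
  have e2 : (Finset.univ.erase 0 : Finset (Fin (k + 1))) =
      insert m.succ ((Finset.univ.erase 0).erase m.succ) := by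
    rw [Finset.insert_erase]; simp
  rw [e1]
  conv_rhs => rw [e2]
  rw [lmarginal_insert' _ (hF.comp (measurable_completeAt _ _)) (by simp),
    lmarginal_insert' _ (hF.comp (measurable_completeAt _ _)) (by simp)]
  congr 1
  ext y
  simp only [Function.comp_apply, ← completeAt_succ_update]
  exact (lintegral_add_right_eq_self
    (fun t => F (completeAt k m.succ (Function.update y 0 t))) _).symm

theorem lmarginal_prod {ι : Type*} [DecidableEq ι] (s : Finset ι) (h : ι → ℝ → ENNReal)
    (hh : ∀ i, Measurable (h i)) (x : ι → ℝ) :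
    lmarginal (fun _ => volume) s (fun v => ∏ j ∈ s, h j (v j)) x = ∏ j ∈ s, ∫⁻ t, h j t := by
  induction s using Finset.induction_on generalizing x with
  | empty => simp
  | insert i s hi ih =>
    rw [lmarginal_insert _ (by fun_prop) hi]
    have : ∀ t, lmarginal (fun _ => volume) s (fun v => ∏ j ∈ insert i s, h j (v j))
        (Function.update x i t) = h i t * ∏ j ∈ s, ∫⁻ t, h j t := fun t => by
      rw [← ih (Function.update x i t)]
      unfold lmarginal
      rw [← lintegral_const_mul]
      · refine lintegral_congr fun y => ?_
        simp only [Finset.prod_insert hi]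
        congr 2
        simp [Function.updateFinset, hi]
      · exact Measurable.comp (g := fun v : ι → ℝ => ∏ j ∈ s, h j (v j)) (by fun_prop)
          measurable_updateFinset
    simp_rw [this]
    rw [lintegral_mul_const _ (hh i), Finset.prod_insert hi]

theorem completeAt_apply_of_ne (k : ℕ) {j₀ j : Fin (k + 1)} (h : j ≠ j₀)
    (v : Fin (k + 1) → ℝ) : completeAt k j₀ v j = v j := by
  simp [completeAt, Function.update_of_ne h]

/-- A weight on the hyperplane whose partial integrals over the variables in `B` are bounded
integrates tensor products of functions of the remaining variables. -/
theorem lintegral_hyperplane_le (k : ℕ) (B : Finset (Fin (k + 1))) (hB : B.Nonempty)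
    (W : (Fin (k + 1) → ℝ) → ENNReal) (hW : Measurable W) (D : ENNReal)
    (hD : ∀ j₀ ∈ B, ∀ g, ∫⁻ h : {j // j ∈ B.erase j₀} → ℝ, W (buildVec k B j₀ g h) ≤ D)
    (h : Fin (k + 1) → ℝ → ENNReal) (hh : ∀ i, Measurable (h i)) :
    ∫⁻ ξ : Fin k → ℝ, W (Fin.cons (∑ i, ξ i) ξ) *
        ∏ j ∈ Bᶜ, h j ((Fin.cons (∑ i, ξ i) ξ : Fin (k + 1) → ℝ) j) ≤
      D * ∏ j ∈ Bᶜ, ∫⁻ t, h j t := by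
  obtain ⟨j₀, hj₀⟩ := hB
  have hP : Measurable fun v : Fin (k + 1) → ℝ => ∏ j ∈ Bᶜ, h j (v j) := by fun_prop
  have hWP : Measurable fun v : Fin (k + 1) → ℝ => W v * ∏ j ∈ Bᶜ, h j (v j) := hW.mul hP
  rw [← lmarginal_completeAt k (fun v => W v * ∏ j ∈ Bᶜ, h j (v j)) hWP j₀ 0]
  have e1 : (Finset.univ.erase j₀ : Finset (Fin (k + 1))) = Bᶜ ∪ B.erase j₀ := by
    ext j
    by_cases hj : j ∈ B
    · simp [hj]
    · have : j ≠ j₀ := fun h => hj (h ▸ hj₀)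
      simp [hj, this]
  have hdisj : Disjoint Bᶜ (B.erase j₀) :=
    (disjoint_compl_left).mono_right (Finset.erase_subset _ _)
  rw [e1, lmarginal_union _ _ (hWP.comp (measurable_completeAt _ _)) hdisj]
  calc _ ≤ lmarginal (fun _ => volume) Bᶜ (fun v => D * ∏ j ∈ Bᶜ, h j (v j)) 0 := by
        refine lmarginal_mono (fun v => ?_) 0
        have : lmarginal (fun _ => volume) (B.erase j₀)
            ((fun v => W v * ∏ j ∈ Bᶜ, h j (v j)) ∘ completeAt k j₀) v =
            (∫⁻ y, W (buildVec k B j₀ v y)) * ∏ j ∈ Bᶜ, h j (v j) := by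
          rw [← lintegral_mul_const]
          · refine lintegral_congr fun y => ?_
            simp only [Function.comp_apply]
            congr 1
            refine Finset.prod_congr rfl fun j hj => ?_
            have hjB : j ∉ B := by simpa using hj
            have hne : j ≠ j₀ := fun h => hjB (h ▸ hj₀)
            rw [completeAt_apply_of_ne k hne]
            simp [Function.updateFinset, hjB]
          · exact (hW.comp (measurable_completeAt _ _)).comp measurable_updateFinset
        rw [this]
        gcongr
        exact hD j₀ hj₀ v
    _ = _ := by
        rw [← lmarginal_prod Bᶜ h hh 0]
        exact lintegral_const_mul _ (hP.comp measurable_updateFinset)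

theorem lintegral_le_of_le_tsum_balls {ν : Measure ℝ} {C₀ θ : ℝ}
    (hν : ∀ α K : ℝ, 0 < K → ν (Metric.ball α K) ≤ ENNReal.ofReal (C₀ * K ^ θ))
    (α : ℝ) (f : ℝ → ENNReal) (a r : ℕ → ℝ) (ha : ∀ n, 0 ≤ a n) (hr : ∀ n, 0 < r n)
    (hf : ∀ x, f x ≤ ∑' n, ENNReal.ofReal (a n) * (Metric.ball α (r n)).indicator 1 x)
    {c q : ℝ} (hc : 0 ≤ c) (hq0 : 0 ≤ q) (hq1 : q < 1)
    (h : ∀ n, a n * (C₀ * r n ^ θ) = c * q ^ n) :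
    ∫⁻ x, f x ∂ν ≤ ENNReal.ofReal (c * (1 - q)⁻¹) := by
  have hm : ∀ n, Measurable ((Metric.ball α (r n)).indicator (1 : ℝ → ENNReal)) := fun n =>
    measurable_one.indicator Metric.isOpen_ball.measurableSet
  calc ∫⁻ x, f x ∂ν
      ≤ ∫⁻ x, ∑' n, ENNReal.ofReal (a n) * (Metric.ball α (r n)).indicator 1 x ∂ν :=
        lintegral_mono hf
    _ = ∑' n, ENNReal.ofReal (a n) * ν (Metric.ball α (r n)) := by
        rw [lintegral_tsum fun n => ((hm n).const_mul _).aemeasurable]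
        congr 1
        ext n
        rw [lintegral_const_mul _ (hm n), lintegral_indicator_one Metric.isOpen_ball.measurableSet]
    _ ≤ ∑' n, ENNReal.ofReal (c * q ^ n) := by
        refine ENNReal.tsum_le_tsum fun n => ?_
        rw [← h n, ENNReal.ofReal_mul (ha n)]
        gcongr
        exact hν α (r n) (hr n)
    _ = ENNReal.ofReal (c * (1 - q)⁻¹) := by
        rw [← tsum_geometric_of_lt_one hq0 hq1, ← tsum_mul_left,
          ENNReal.ofReal_tsum_of_nonneg (fun n => by positivity)
            ((summable_geometric_of_lt_one hq0 hq1).mul_left c)]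

theorem lintegral_inv_tail_le {C₀ θ : ℝ} (hC₀ : 0 < C₀) (hθ1 : θ < 1) :
    ∃ C > 0, ∀ ν : Measure ℝ,
      (∀ α K : ℝ, 0 < K → ν (Metric.ball α K) ≤ ENNReal.ofReal (C₀ * K ^ θ)) →
      ∀ α K : ℝ, 0 < K → ∫⁻ x, ENNReal.ofReal (if K < |x - α| then |x - α|⁻¹ else 0) ∂ν ≤
        ENNReal.ofReal (C * K ^ (θ - 1)) := by
  have hq1 : (2 : ℝ) ^ (θ - 1) < 1 :=
    Real.rpow_lt_one_of_one_lt_of_neg one_lt_two (by linarith)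
  have hq : 0 < 1 - (2 : ℝ) ^ (θ - 1) := by linarith
  refine ⟨C₀ * 2 ^ θ * (1 - 2 ^ (θ - 1))⁻¹, by positivity, fun ν hν α K hK => ?_⟩
  refine (lintegral_le_of_le_tsum_balls hν α _ (fun n => (2 ^ n * K)⁻¹) (fun n => 2 ^ (n + 1) * K)
    (fun n => by positivity) (fun n => by positivity) (fun x => ?_)
    (c := C₀ * 2 ^ θ * K ^ (θ - 1)) (q := 2 ^ (θ - 1)) (by positivity) (by positivity) hq1
    (fun n => ?_)).trans_eq ?_
  · split_ifs with hx
    · obtain ⟨n, hn1, hn2⟩ := exists_nat_pow_near (x := |x - α| / K) (y := (2 : ℝ))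
        ((one_le_div hK).2 hx.le) one_lt_two
      rw [le_div_iff₀ hK] at hn1
      rw [div_lt_iff₀ hK] at hn2
      refine le_trans ?_ (ENNReal.le_tsum n)
      rw [Set.indicator_of_mem (by simpa [Real.dist_eq] using hn2), Pi.one_apply, mul_one]
      gcongr
    · simp
  · rw [Real.mul_rpow (by positivity) hK.le, ← Real.rpow_natCast_mul zero_le_two,
      mul_comm ((n + 1 : ℕ) : ℝ), Real.rpow_mul_natCast zero_le_two, pow_succ,
      Real.rpow_sub_one two_ne_zero, Real.rpow_sub_one hK.ne', div_pow]
    field_simp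
  · congr 1
    ring

theorem lintegral_bracket_near_le {C₀ θ β : ℝ} (hC₀ : 0 < C₀) (hβ : 0 < β) (hβθ : 2 * β < θ) :
    ∃ C > 0, ∀ ν : Measure ℝ,
      (∀ α K : ℝ, 0 < K → ν (Metric.ball α K) ≤ ENNReal.ofReal (C₀ * K ^ θ)) →
      ∀ α K : ℝ, 0 < K →
        ∫⁻ x, ENNReal.ofReal (if |x - α| ≤ K then (1 + (x - α) ^ 2) ^ (-β) else 0) ∂ν ≤
          ENNReal.ofReal (C * K ^ (θ - 2 * β)) := by
  set q : ℝ := (1 / 2) ^ (θ - 2 * β) with hqdef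
  have hq1 : q < 1 := Real.rpow_lt_one (by norm_num) (by norm_num) (by linarith)
  have hq : 0 < 1 - q := by linarith
  refine ⟨C₀ * 2 ^ (2 * β) * 2 ^ θ * (1 - q)⁻¹, by positivity, fun ν hν α K hK => ?_⟩
  refine (lintegral_le_of_le_tsum_balls hν α _ (fun n => ((1 / 2) ^ n * (K / 2)) ^ (-(2 * β)))
    (fun n => (1 / 2) ^ n * (2 * K))
    (fun n => by positivity) (fun n => by positivity) (fun x => ?_)
    (c := C₀ * 2 ^ (2 * β) * 2 ^ θ * K ^ (θ - 2 * β)) (q := q) (by positivity) (by positivity) hq1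
    (fun n => ?_)).trans_eq ?_
  · split_ifs with hx
    · have key : ∀ n : ℕ, |x - α| < (1 / 2) ^ n * (2 * K) →
          ((1 / 2) ^ n * (K / 2)) ^ 2 ≤ 1 + (x - α) ^ 2 →
          ENNReal.ofReal ((1 + (x - α) ^ 2) ^ (-β)) ≤
            ∑' n : ℕ, ENNReal.ofReal (((1 / 2) ^ n * (K / 2)) ^ (-(2 * β))) *
              (Metric.ball α ((1 / 2) ^ n * (2 * K))).indicator 1 x := by
        intro n h1 h2
        refine le_trans ?_ (ENNReal.le_tsum n)
        rw [Set.indicator_of_mem (by simpa [Real.dist_eq] using h1), Pi.one_apply, mul_one]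
        refine ENNReal.ofReal_le_ofReal ?_
        have : ((1 / 2) ^ n * (K / 2)) ^ (-(2 * β)) = (((1 / 2) ^ n * (K / 2)) ^ 2) ^ (-β) := by
          rw [← Real.rpow_natCast_mul (by positivity)]
          congr 1
          push_cast
          ring
        rw [this]
        exact Real.rpow_le_rpow_of_nonpos (by positivity) h2 (by linarith)
      by_cases hx0 : x = α
      · obtain ⟨n, hn⟩ := exists_pow_lt_of_lt_one (show (0 : ℝ) < (K / 2)⁻¹ by positivity)
          (show (1 / 2 : ℝ) < 1 by norm_num)
        refine key n (by rw [hx0, sub_self, abs_zero]; positivity) ?_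
        have h3 : (1 / 2) ^ n * (K / 2) ≤ 1 := by
          have := mul_le_mul_of_nonneg_right hn.le (show 0 ≤ K / 2 by positivity)
          rwa [inv_mul_cancel₀ (by positivity)] at this
        have h4 : ((1 / 2) ^ n * (K / 2)) ^ 2 ≤ 1 := pow_le_one₀ (by positivity) h3
        nlinarith [sq_nonneg (x - α)]
      · have hpos : 0 < |x - α| := abs_pos.2 (sub_ne_zero.2 hx0)
        obtain ⟨n, hn1, hn2⟩ := exists_nat_pow_near (x := K / |x - α|) (y := (2 : ℝ))
          ((one_le_div hpos).2 hx) one_lt_two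
        rw [le_div_iff₀ hpos] at hn1
        rw [div_lt_iff₀ hpos] at hn2
        have e : ∀ z : ℝ, (1 / 2) ^ n * z = z / 2 ^ n := fun z => by
          rw [one_div_pow]; ring
        refine key n ?_ ?_
        · rw [e, lt_div_iff₀ (by positivity)]
          nlinarith
        · have h5 : (1 / 2) ^ n * (K / 2) ≤ |x - α| := by
            rw [e, div_le_iff₀ (by positivity)]
            rw [pow_succ] at hn2
            nlinarith
          have h6 := pow_le_pow_left₀ (by positivity) h5 2
          rw [sq_abs] at h6
          linarith
    · simp
  · have e1 : ((1 / 2 : ℝ) ^ n * (K / 2)) ^ (-(2 * β)) =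
        ((1 / 2) ^ n) ^ (-(2 * β)) * K ^ (-(2 * β)) * 2 ^ (2 * β) := by
      rw [Real.mul_rpow (by positivity) (by positivity), Real.div_rpow hK.le zero_le_two,
        Real.rpow_neg zero_le_two, div_inv_eq_mul, mul_assoc]
    have e2 : ((1 / 2 : ℝ) ^ n * (2 * K)) ^ θ = ((1 / 2) ^ n) ^ θ * (2 ^ θ * K ^ θ) := by
      rw [Real.mul_rpow (by positivity) (by positivity), Real.mul_rpow zero_le_two hK.le]
    have e3 : q ^ n = ((1 / 2 : ℝ) ^ n) ^ (-(2 * β)) * ((1 / 2) ^ n) ^ θ := by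
      rw [← Real.rpow_add (by positivity), hqdef, ← Real.rpow_mul_natCast (by norm_num),
        ← Real.rpow_natCast_mul (by norm_num)]
      congr 1
      ring
    have e4 : K ^ (θ - 2 * β) = K ^ (-(2 * β)) * K ^ θ := by
      rw [← Real.rpow_add hK]
      congr 1
      ring
    rw [e1, e2, e3, e4]
    ring
  · congr 1
    ring

/-- The weight gained from the resonance function `φ` when one of the time frequencies is
compared with `y`. -/
def resKernel (β K φ y : ℝ) : ℝ :=
  if K < |φ| then |φ|⁻¹ * (1 + |φ| ^ β * (1 + y ^ 2) ^ (-(β / 2))) ^ 2 else 0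

theorem measurable_resKernel (β K : ℝ) : Measurable fun p : ℝ × ℝ => resKernel β K p.1 p.2 := by
  unfold resKernel
  refine Measurable.ite ?_ (by fun_prop) measurable_const
  exact measurableSet_lt measurable_const (by fun_prop)

theorem resKernel_le {β K φ y : ℝ} (hβ : 0 < β) (hβ1 : 2 * β < 1) (hK : 0 < K) :
    resKernel β K φ y ≤ 4 * (if K < |φ| then |φ|⁻¹ else 0) + 2 * (if K < |y| then |y|⁻¹ else 0) +
      2 * K ^ (2 * β - 1) * (if |y| ≤ K then (1 + y ^ 2) ^ (-β) else 0) := by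
  unfold resKernel
  by_cases hφ : K < |φ|
  swap
  · simp only [if_neg hφ]
    positivity
  have hφ0 : 0 < |φ| := hK.trans hφ
  simp only [if_pos hφ]
  have hp : (|φ| ^ β * (1 + y ^ 2) ^ (-(β / 2))) ^ 2 = |φ| ^ (2 * β) * (1 + y ^ 2) ^ (-β) := by
    rw [mul_pow, ← Real.rpow_mul_natCast (abs_nonneg _), ← Real.rpow_mul_natCast (by positivity)]
    congr 2 <;> push_cast <;> ring
  have h1 : |φ|⁻¹ * (1 + |φ| ^ β * (1 + y ^ 2) ^ (-(β / 2))) ^ 2 ≤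
      2 * |φ|⁻¹ + 2 * (|φ| ^ (2 * β - 1) * (1 + y ^ 2) ^ (-β)) := by
    have e : |φ| ^ (2 * β - 1) * (1 + y ^ 2) ^ (-β) =
        |φ|⁻¹ * (|φ| ^ β * (1 + y ^ 2) ^ (-(β / 2))) ^ 2 := by
      rw [hp, Real.rpow_sub_one hφ0.ne']
      field_simp
    rw [e]
    have := inv_pos.2 hφ0
    nlinarith [mul_nonneg this.le (sq_nonneg (1 - |φ| ^ β * (1 + y ^ 2) ^ (-(β / 2))))]
  refine h1.trans ?_
  by_cases hy : K < |y|
  · have hy0 : 0 < |y| := hK.trans hy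
    simp only [if_pos hy, if_neg (not_le.2 hy), mul_zero, add_zero]
    have h2 : (1 + y ^ 2) ^ (-β) ≤ |y| ^ (-(2 * β)) := by
      have : |y| ^ (-(2 * β)) = (|y| ^ 2) ^ (-β) := by
        rw [← Real.rpow_natCast_mul (abs_nonneg _)]
        congr 1
        push_cast
        ring
      rw [this, sq_abs]
      have : 0 < y ^ 2 := by rw [← sq_abs]; positivity
      exact Real.rpow_le_rpow_of_nonpos this (by linarith) (by linarith)
    have h3 : |φ| ^ (2 * β - 1) * |y| ^ (-(2 * β)) ≤ |φ|⁻¹ + |y|⁻¹ := by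
      rcases le_total |φ| |y| with h | h
      · have : |y| ^ (-(2 * β)) ≤ |φ| ^ (-(2 * β)) :=
          Real.rpow_le_rpow_of_nonpos hφ0 h (by linarith)
        calc _ ≤ |φ| ^ (2 * β - 1) * |φ| ^ (-(2 * β)) := by gcongr
          _ = |φ|⁻¹ := by
            rw [← Real.rpow_add hφ0, ← Real.rpow_neg_one]; congr 1; ring
          _ ≤ _ := by linarith [inv_pos.2 hy0]
      · have : |φ| ^ (2 * β - 1) ≤ |y| ^ (2 * β - 1) :=
          Real.rpow_le_rpow_of_nonpos hy0 h (by linarith)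
        calc _ ≤ |y| ^ (2 * β - 1) * |y| ^ (-(2 * β)) := by gcongr
          _ = |y|⁻¹ := by
            rw [← Real.rpow_add hy0, ← Real.rpow_neg_one]; congr 1; ring
          _ ≤ _ := by linarith [inv_pos.2 hφ0]
    have h4 : |φ| ^ (2 * β - 1) * (1 + y ^ 2) ^ (-β) ≤ |φ| ^ (2 * β - 1) * |y| ^ (-(2 * β)) := by
      gcongr
    linarith
  · simp only [if_neg hy, if_pos (not_lt.1 hy), mul_zero, add_zero]
    have h2 : |φ| ^ (2 * β - 1) ≤ K ^ (2 * β - 1) :=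
      Real.rpow_le_rpow_of_nonpos hK hφ.le (by linarith)
    have h3 : |φ| ^ (2 * β - 1) * (1 + y ^ 2) ^ (-β) ≤ K ^ (2 * β - 1) * (1 + y ^ 2) ^ (-β) := by
      gcongr
    have := inv_pos.2 hφ0
    linarith

theorem lintegral_resKernel_le {C₀ θ β : ℝ} (hC₀ : 0 < C₀) (hθ1 : θ < 1) (hβ : 0 < β)
    (hβθ : 2 * β < θ) :
    ∃ C > 0, ∀ ν : Measure ℝ,
      (∀ α K : ℝ, 0 < K → ν (Metric.ball α K) ≤ ENNReal.ofReal (C₀ * K ^ θ)) →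
      ∀ α K : ℝ, 0 < K → ∫⁻ x, ENNReal.ofReal (resKernel β K x (x - α)) ∂ν ≤
        ENNReal.ofReal (C * K ^ (θ - 1)) := by
  obtain ⟨C₁, hC₁, h₁⟩ := lintegral_inv_tail_le hC₀ hθ1
  obtain ⟨C₂, hC₂, h₂⟩ := lintegral_bracket_near_le hC₀ hβ hβθ
  refine ⟨6 * C₁ + 2 * C₂, by positivity, fun ν hν α K hK => ?_⟩
  have m1 : ∀ α : ℝ, Measurable fun x : ℝ => if K < |x - α| then |x - α|⁻¹ else 0 := fun α =>
    Measurable.ite (measurableSet_lt measurable_const (by fun_prop)) (by fun_prop) measurable_const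
  have m2 : Measurable fun x : ℝ => if |x - α| ≤ K then (1 + (x - α) ^ 2) ^ (-β) else 0 :=
    Measurable.ite (measurableSet_le (by fun_prop) measurable_const) (by fun_prop) measurable_const
  have h0 := h₁ ν hν 0 K hK
  simp only [sub_zero] at h0
  have m0 := m1 0
  simp only [sub_zero] at m0
  calc ∫⁻ x, ENNReal.ofReal (resKernel β K x (x - α)) ∂ν
      ≤ ∫⁻ x, (ENNReal.ofReal 4 * ENNReal.ofReal (if K < |x| then |x|⁻¹ else 0) +
          ENNReal.ofReal 2 * ENNReal.ofReal (if K < |x - α| then |x - α|⁻¹ else 0)) +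
          ENNReal.ofReal (2 * K ^ (2 * β - 1)) *
            ENNReal.ofReal (if |x - α| ≤ K then (1 + (x - α) ^ 2) ^ (-β) else 0) ∂ν := by
        refine lintegral_mono fun x => ?_
        rw [← ENNReal.ofReal_mul (by positivity), ← ENNReal.ofReal_mul (by positivity),
          ← ENNReal.ofReal_mul (by positivity), ← ENNReal.ofReal_add (by positivity) (by positivity),
          ← ENNReal.ofReal_add (by positivity) (by positivity)]
        exact ENNReal.ofReal_le_ofReal (resKernel_le hβ (by linarith) hK)
    _ ≤ (ENNReal.ofReal 4 * ENNReal.ofReal (C₁ * K ^ (θ - 1)) +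
          ENNReal.ofReal 2 * ENNReal.ofReal (C₁ * K ^ (θ - 1))) +
          ENNReal.ofReal (2 * K ^ (2 * β - 1)) * ENNReal.ofReal (C₂ * K ^ (θ - 2 * β)) := by
        rw [lintegral_add_left (by fun_prop), lintegral_add_left (by fun_prop),
          lintegral_const_mul _ (by fun_prop), lintegral_const_mul _ ((m1 α).ennreal_ofReal),
          lintegral_const_mul _ (by fun_prop)]
        gcongr
        · exact h₁ ν hν α K hK
        · exact h₂ ν hν α K hK
    _ = ENNReal.ofReal ((6 * C₁ + 2 * C₂) * K ^ (θ - 1)) := by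
        rw [← ENNReal.ofReal_mul (by positivity), ← ENNReal.ofReal_mul (by positivity),
          ← ENNReal.ofReal_mul (by positivity), ← ENNReal.ofReal_add (by positivity) (by positivity),
          ← ENNReal.ofReal_add (by positivity) (by positivity)]
        have : K ^ (θ - 1) = K ^ (2 * β - 1) * K ^ (θ - 2 * β) := by
          rw [← Real.rpow_add hK]; congr 1; ring
        congr 1
        rw [this]
        ring

theorem measurable_buildVec (k : ℕ) (B : Finset (Fin (k + 1))) (j₀ : Fin (k + 1))
    (g : Fin (k + 1) → ℝ) : Measurable (buildVec k B j₀ g) :=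
  (measurable_completeAt k j₀).comp (measurable_updateFinset (s := B.erase j₀) (x := g))

theorem measurable_tailVec (k : ℕ) : Measurable (tailVec k) := by
  unfold tailVec; fun_prop

theorem measurable_PhiFull (k : ℕ) : Measurable (PhiFull k) := by
  unfold PhiFull; fun_prop

/-- A frequency-restricted estimate controls weights that are functions of the resonance
function as soon as these are controlled for measures with the same growth on balls. -/
theorem FreqRestricted.lintegral_le {k : ℕ} {M' : (Fin k → ℝ) → ℝ} {B : Finset (Fin (k + 1))}
    {C₀ θ : ℝ} (hFR : FreqRestricted k M' B C₀ θ) (hM' : Measurable M')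
    {f : ℝ → ENNReal} (hf : Measurable f) {D : ENNReal}
    (hD : ∀ ν : Measure ℝ,
      (∀ α K : ℝ, 0 < K → ν (Metric.ball α K) ≤ ENNReal.ofReal (C₀ * K ^ θ)) →
      ∫⁻ x, f x ∂ν ≤ D)
    (j₀ : Fin (k + 1)) (hj₀ : j₀ ∈ B) (g : Fin (k + 1) → ℝ) :
    ∫⁻ h : {j // j ∈ B.erase j₀} → ℝ, ENNReal.ofReal (M' (tailVec k (buildVec k B j₀ g h))) *
      f (PhiFull k (buildVec k B j₀ g h)) ≤ D := by
  have hb := measurable_buildVec k B j₀ g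
  have hρ : Measurable fun h : {j // j ∈ B.erase j₀} → ℝ =>
      ENNReal.ofReal (M' (tailVec k (buildVec k B j₀ g h))) :=
    (hM'.comp ((measurable_tailVec k).comp hb)).ennreal_ofReal
  have hφ : Measurable fun h : {j // j ∈ B.erase j₀} → ℝ => PhiFull k (buildVec k B j₀ g h) :=
    (measurable_PhiFull k).comp hb
  have key := hD (((volume : Measure ({j // j ∈ B.erase j₀} → ℝ)).withDensity
    fun h => ENNReal.ofReal (M' (tailVec k (buildVec k B j₀ g h)))).map
      fun h => PhiFull k (buildVec k B j₀ g h)) ?_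
  · have hfφ : Measurable fun h : {j // j ∈ B.erase j₀} → ℝ =>
        f (PhiFull k (buildVec k B j₀ g h)) := hf.comp hφ
    rw [lintegral_map hf hφ, lintegral_withDensity_eq_lintegral_mul _ hρ hfφ] at key
    exact key
  · intro α K hK
    have hball : MeasurableSet (Metric.ball α K) := Metric.isOpen_ball.measurableSet
    rw [Measure.map_apply hφ hball, withDensity_apply _ (hφ hball),
      ← lintegral_indicator (hφ hball)]
    refine le_trans (lintegral_mono fun h => ?_) (hFR K hK α j₀ hj₀ g)
    by_cases hh : |PhiFull k (buildVec k B j₀ g h) - α| < K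
    · rw [Set.indicator_of_mem (by simpa [Real.dist_eq] using hh), if_pos hh, mul_one]
    · rw [Set.indicator_of_notMem (by simpa [Real.dist_eq] using hh)]
      exact zero_le

theorem measurable_cons_sum (k : ℕ) :
    Measurable fun ξ : Fin k → ℝ => (Fin.cons (∑ i, ξ i) ξ : Fin (k + 1) → ℝ) := by
  refine measurable_pi_lambda _ fun j => ?_
  refine Fin.cases ?_ (fun i => ?_) j
  · simp only [Fin.cons_zero]; fun_prop
  · simp only [Fin.cons_succ]; fun_prop

theorem tailVec_cons (k : ℕ) (a : ℝ) (ξ : Fin k → ℝ) : tailVec k (Fin.cons a ξ) = ξ := by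
  ext i
  simp [tailVec]

theorem PhiFull_cons_sum (k : ℕ) (ξ : Fin k → ℝ) :
    PhiFull k (Fin.cons (∑ i, ξ i) ξ) = PhiK k ξ := by
  simp [PhiFull, PhiK]

theorem measurable_PhiK (k : ℕ) : Measurable (PhiK k) := by
  unfold PhiK; fun_prop

theorem lintegral_sqrt_mul_sqrt_le {X : Type*} [MeasurableSpace X] {μ : Measure X}
    {f g : X → ENNReal} (hf : Measurable f) (hg : Measurable g) :
    ∫⁻ x, f x ^ (1 / 2 : ℝ) * g x ^ (1 / 2 : ℝ) ∂μ ≤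
      (∫⁻ x, f x ∂μ) ^ (1 / 2 : ℝ) * (∫⁻ x, g x ∂μ) ^ (1 / 2 : ℝ) :=
  ENNReal.lintegral_mul_norm_pow_le hf.aemeasurable hg.aemeasurable
    (by norm_num) (by norm_num) (by norm_num)

theorem sq_rpow_half (x : ENNReal) : (x ^ 2) ^ (1 / 2 : ℝ) = x := by
  rw [← ENNReal.rpow_natCast_mul]; norm_num

theorem rpow_half_sq (x : ENNReal) : (x ^ (1 / 2 : ℝ)) ^ 2 = x := by
  rw [← ENNReal.rpow_mul_natCast]; norm_num

theorem rpow_half_mul_self (x : ENNReal) : x ^ (1 / 2 : ℝ) * x ^ (1 / 2 : ℝ) = x := by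
  rw [← sq, rpow_half_sq]

theorem mul_rpow_half (x y : ENNReal) :
    (x * y) ^ (1 / 2 : ℝ) = x ^ (1 / 2 : ℝ) * y ^ (1 / 2 : ℝ) :=
  ENNReal.mul_rpow_of_nonneg _ _ (by norm_num)

theorem prod_rpow_half {ι : Type*} (s : Finset ι) (f : ι → ENNReal) :
    ∏ i ∈ s, f i ^ (1 / 2 : ℝ) = (∏ i ∈ s, f i) ^ (1 / 2 : ℝ) :=
  ENNReal.prod_rpow_of_nonneg (by norm_num)

theorem lintegral_mul_lintegral_mul_swap {X Y : Type*} [MeasurableSpace X] [MeasurableSpace Y]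
    {μ : Measure X} {ν : Measure Y} [SFinite μ] [SFinite ν] {A P : X → ENNReal}
    {G : X × Y → ENNReal} (hA : Measurable A) (hP : Measurable P) (hG : Measurable G) :
    ∫⁻ x, A x * (∫⁻ y, G (x, y) ∂ν) * P x ∂μ = ∫⁻ y, ∫⁻ x, A x * G (x, y) * P x ∂μ ∂ν := by
  rw [← lintegral_lintegral_swap (Measurable.aemeasurable
    (((hA.comp measurable_fst).mul hG).mul (hP.comp measurable_fst)))]
  refine lintegral_congr fun x => ?_
  have h0 : Measurable fun y => G (x, y) := hG.comp measurable_prodMk_left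
  rw [lintegral_mul_const _ (h0.const_mul _), lintegral_const_mul _ h0]

/-- The multilinear estimate on the resonance hyperplane in which one factor `f₁` carries an
additional time frequency, constrained through the resonance kernel. -/
theorem lintegral_hyperplane_resKernel_le (k : ℕ) (i : Fin (k + 1)) (B : Finset (Fin (k + 1)))
    (hi : i ∉ B) (hB : B.Nonempty) {M' : (Fin k → ℝ) → ℝ} (hM' : Measurable M')
    {β K : ℝ} {D : ENNReal}
    (hD : ∀ α : ℝ, ∀ j₀ ∈ B, ∀ g, ∫⁻ h : {j // j ∈ B.erase j₀} → ℝ,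
      ENNReal.ofReal (M' (tailVec k (buildVec k B j₀ g h))) *
        ENNReal.ofReal (resKernel β K (PhiFull k (buildVec k B j₀ g h))
          (PhiFull k (buildVec k B j₀ g h) - α)) ≤ D)
    (S : ℝ) (f₁ : ℝ × ℝ → ENNReal) (hf₁ : Measurable f₁)
    (H : Fin (k + 1) → ℝ → ENNReal) (hH : ∀ j, Measurable (H j)) :
    ∫⁻ ξ : Fin k → ℝ, ENNReal.ofReal (M' ξ) *
        (∫⁻ σ, ENNReal.ofReal (resKernel β K (PhiK k ξ) (PhiK k ξ - (σ + S))) *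
          f₁ (σ, (Fin.cons (∑ i, ξ i) ξ : Fin (k + 1) → ℝ) i)) *
        ∏ j ∈ Bᶜ.erase i, H j ((Fin.cons (∑ i, ξ i) ξ : Fin (k + 1) → ℝ) j) ≤
      D * (∫⁻ q, f₁ q) * ∏ j ∈ Bᶜ.erase i, ∫⁻ t, H j t := by
  have hiB : i ∈ Bᶜ := by simpa using hi
  have hc := measurable_cons_sum k
  have hcj : ∀ j, Measurable fun ξ : Fin k → ℝ =>
      (Fin.cons (∑ i, ξ i) ξ : Fin (k + 1) → ℝ) j := fun j => (measurable_pi_apply j).comp hc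
  have hΦ := measurable_PhiK k
  have hker2 : Measurable fun p : (Fin k → ℝ) × ℝ =>
      ENNReal.ofReal (resKernel β K (PhiK k p.1) (PhiK k p.1 - (p.2 + S))) *
        f₁ (p.2, (Fin.cons (∑ i, p.1 i) p.1 : Fin (k + 1) → ℝ) i) := by
    refine Measurable.mul ?_ ?_
    · exact ((measurable_resKernel β K).comp ((hΦ.comp measurable_fst).prodMk
        ((hΦ.comp measurable_fst).sub (measurable_snd.add_const S)))).ennreal_ofReal
    · exact hf₁.comp (measurable_snd.prodMk ((hcj i).comp measurable_fst))
  have hprod : Measurable fun ξ : Fin k → ℝ =>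
      ∏ j ∈ Bᶜ.erase i, H j ((Fin.cons (∑ i, ξ i) ξ : Fin (k + 1) → ℝ) j) :=
    Finset.measurable_prod _ fun j _ => (hH j).comp (hcj j)
  have hswap := lintegral_mul_lintegral_mul_swap (μ := (volume : Measure (Fin k → ℝ)))
    (ν := (volume : Measure ℝ)) hM'.ennreal_ofReal hprod hker2
  calc _ = _ := hswap
    _ ≤ ∫⁻ σ, D * (∫⁻ t, f₁ (σ, t)) * ∏ j ∈ Bᶜ.erase i, ∫⁻ t, H j t := by
        refine lintegral_mono fun σ => ?_
        have key := lintegral_hyperplane_le k B hB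
          (fun η => ENNReal.ofReal (M' (tailVec k η)) *
            ENNReal.ofReal (resKernel β K (PhiFull k η) (PhiFull k η - (σ + S)))) ?_ D
          (hD (σ + S)) (Function.update H i fun t => f₁ (σ, t)) ?_
        · rw [← Finset.mul_prod_erase _ _ hiB, Function.update_self] at key
          simp only [tailVec_cons, PhiFull_cons_sum, ← Finset.mul_prod_erase _ _ hiB,
            Function.update_self] at key
          have e1 : ∀ v : Fin (k + 1) → ℝ, ∏ j ∈ Bᶜ.erase i,
              Function.update H i (fun t => f₁ (σ, t)) j (v j) = ∏ j ∈ Bᶜ.erase i, H j (v j) :=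
            fun v => Finset.prod_congr rfl fun j hj => by
              rw [Function.update_of_ne (Finset.ne_of_mem_erase hj)]
          have e2 : ∏ j ∈ Bᶜ.erase i, ∫⁻ t, Function.update H i (fun t => f₁ (σ, t)) j t =
              ∏ j ∈ Bᶜ.erase i, ∫⁻ t, H j t :=
            Finset.prod_congr rfl fun j hj => by
              rw [Function.update_of_ne (Finset.ne_of_mem_erase hj)]
          simp only [e1] at key
          rw [e2] at key
          simpa only [mul_assoc] using key
        · have hΦF := measurable_PhiFull k
          exact ((hM'.comp (measurable_tailVec k)).ennreal_ofReal).mul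
            ((measurable_resKernel β K).comp (hΦF.prodMk (hΦF.sub_const _))).ennreal_ofReal
        · intro j
          by_cases hj : j = i
          · subst hj
            rw [Function.update_self]
            exact hf₁.comp measurable_prodMk_left
          · rw [Function.update_of_ne hj]
            exact hH j
    _ = _ := by
        have hI : Measurable fun σ => ∫⁻ t, f₁ (σ, t) := hf₁.lintegral_prod_right'
        rw [lintegral_mul_const _ (hI.const_mul _), lintegral_const_mul _ hI,
          Measure.volume_eq_prod, lintegral_prod _ hf₁.aemeasurable]

/-- The truncated inverse of the resonance function. -/
def invKernel (K φ : ℝ) : ℝ := if K < |φ| then |φ|⁻¹ else 0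

theorem measurable_invKernel (K : ℝ) : Measurable (invKernel K) := by
  unfold invKernel
  exact Measurable.ite (measurableSet_lt measurable_const (by fun_prop)) (by fun_prop)
    measurable_const

theorem invKernel_le_resKernel (β K φ y : ℝ) : invKernel K φ ≤ resKernel β K φ y := by
  unfold invKernel resKernel
  split_ifs with h
  · have h1 : 0 ≤ |φ| ^ β * (1 + y ^ 2) ^ (-(β / 2)) := by positivity
    exact le_mul_of_one_le_right (by positivity) (one_le_pow₀ (by linarith))
  · exact le_rfl

theorem prod_erase_one_cons (n : ℕ) (a : ℝ → ENNReal) (c : ℝ → ENNReal) (H : Fin n → ℝ → ENNReal)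
    (η : Fin (n + 2) → ℝ) :
    ∏ j ∈ Finset.univ.erase (1 : Fin (n + 2)),
      (Fin.cons a (Fin.cons c H : Fin (n + 1) → ℝ → ENNReal) : Fin (n + 2) → ℝ → ENNReal) j
        (η j) = a (η 0) * ∏ j : Fin n, H j (η j.succ.succ) := by
  set HH : Fin (n + 2) → ℝ → ENNReal := Fin.cons a (Fin.cons c H : Fin (n + 1) → ℝ → ENNReal)
  have h : ∏ j ∈ Finset.univ.erase (1 : Fin (n + 2)), HH j (η j) =
      ∏ j, Function.update (fun j => HH j (η j)) 1 1 j := by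
    rw [← Finset.mul_prod_erase _ _ (Finset.mem_univ (1 : Fin (n + 2))), Function.update_self,
      one_mul]
    exact Finset.prod_congr rfl fun j hj => by
      rw [Function.update_of_ne (Finset.ne_of_mem_erase hj)]
  rw [h, Fin.prod_univ_succ, Fin.prod_univ_succ]
  have h01 : (0 : Fin (n + 2)) ≠ 1 := Fin.zero_ne_one
  have h11 : (Fin.succ (0 : Fin (n + 1)) : Fin (n + 2)) = 1 := rfl
  rw [Function.update_of_ne h01, h11, Function.update_self, one_mul]
  congr 1

theorem lintegral_hyperplane_sqrt_le (n : ℕ) (B : Finset (Fin (n + 2))) (hi : (1 : Fin (n + 2)) ∉ B)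
    (hB : B.Nonempty) {M' M'' : (Fin (n + 1) → ℝ) → ℝ} (hM' : Measurable M')
    (hM'' : Measurable M'') {β K : ℝ} {D : ENNReal}
    (hD : ∀ α : ℝ, ∀ j₀ ∈ B, ∀ g, ∫⁻ h : {j // j ∈ B.erase j₀} → ℝ,
      ENNReal.ofReal (M' (tailVec (n + 1) (buildVec (n + 1) B j₀ g h))) *
        ENNReal.ofReal (resKernel β K (PhiFull (n + 1) (buildVec (n + 1) B j₀ g h))
          (PhiFull (n + 1) (buildVec (n + 1) B j₀ g h) - α)) ≤ D)
    (hD' : ∀ j₀ ∈ Bᶜ, ∀ g, ∫⁻ h : {j // j ∈ Bᶜ.erase j₀} → ℝ,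
      ENNReal.ofReal (M'' (tailVec (n + 1) (buildVec (n + 1) Bᶜ j₀ g h))) *
        ENNReal.ofReal (invKernel K (PhiFull (n + 1) (buildVec (n + 1) Bᶜ j₀ g h))) ≤ D)
    (S : ℝ) {F₀ F₁ : ℝ × ℝ → ENNReal} (hF₀ : Measurable F₀) (hF₁ : Measurable F₁)
    {H : Fin n → ℝ → ENNReal} (hH : ∀ j, Measurable (H j)) :
    ∫⁻ ξ : Fin (n + 1) → ℝ, (ENNReal.ofReal (M' ξ) * ENNReal.ofReal (M'' ξ)) ^ (1 / 2 : ℝ) *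
        (∫⁻ σ, (ENNReal.ofReal (invKernel K (PhiK (n + 1) ξ)) * ENNReal.ofReal
            (resKernel β K (PhiK (n + 1) ξ) (PhiK (n + 1) ξ - (σ + S)))) ^ (1 / 2 : ℝ) *
          F₀ (σ + S - PhiK (n + 1) ξ, ∑ i, ξ i) ^ (1 / 2 : ℝ) * F₁ (σ, ξ 0) ^ (1 / 2 : ℝ)) *
        ∏ j : Fin n, H j (ξ j.succ) ^ (1 / 2 : ℝ) ≤
      D * (∫⁻ q, F₀ q) ^ (1 / 2 : ℝ) * (∫⁻ q, F₁ q) ^ (1 / 2 : ℝ) *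
        ∏ j : Fin n, (∫⁻ t, H j t) ^ (1 / 2 : ℝ) := by
  set HH : Fin (n + 2) → ℝ → ENNReal :=
    Fin.cons (fun t => ∫⁻ σ, F₀ (σ, t)) (Fin.cons 1 H : Fin (n + 1) → ℝ → ENNReal) with hHH
  have hHm : ∀ j, Measurable (HH j) := by
    intro j
    refine Fin.cases ?_ (fun j => Fin.cases ?_ (fun j => ?_) j) j
    · exact hF₀.lintegral_prod_left'
    · exact measurable_const
    · simpa [HH] using hH j
  have h1B : (1 : Fin (n + 2)) ∈ Bᶜ := by simpa using hi
  have hΦ := measurable_PhiK (n + 1)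
  have hΦF := measurable_PhiFull (n + 1)
  have hc := measurable_cons_sum (n + 1)
  have hcj : ∀ j, Measurable fun ξ : Fin (n + 1) → ℝ =>
      (Fin.cons (∑ i, ξ i) ξ : Fin (n + 2) → ℝ) j := fun j => (measurable_pi_apply j).comp hc
  have hη1 : ∀ ξ : Fin (n + 1) → ℝ, (Fin.cons (∑ i, ξ i) ξ : Fin (n + 2) → ℝ) 1 = ξ 0 :=
    fun ξ => rfl
  have hsplit : ∀ p : Fin (n + 2) → ENNReal,
      (∏ j ∈ Bᶜ.erase 1, p j) * ∏ j ∈ Bᶜᶜ, p j = ∏ j ∈ Finset.univ.erase 1, p j := by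
    intro p
    rw [compl_compl, ← Finset.prod_union]
    · congr 1
      ext j
      by_cases hj : j ∈ B
      · have : j ≠ 1 := fun h => hi (h ▸ hj)
        simp [hj, this]
      · simp [hj]
    · rw [Finset.disjoint_left]
      intro j hj
      simpa using (Finset.mem_of_mem_erase hj)
  have e1 := lintegral_hyperplane_resKernel_le (n + 1) 1 B hi hB hM' hD S F₁ hF₁ HH hHm
  have e2 := lintegral_hyperplane_le (n + 1) Bᶜ ⟨1, h1B⟩
    (fun η => ENNReal.ofReal (M'' (tailVec (n + 1) η)) *
      ENNReal.ofReal (invKernel K (PhiFull (n + 1) η)))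
    (((hM''.comp (measurable_tailVec (n + 1))).ennreal_ofReal).mul
      ((measurable_invKernel K).comp hΦF).ennreal_ofReal) D hD' HH hHm
  simp only [tailVec_cons, PhiFull_cons_sum] at e2
  simp only [hη1] at e1
  have hR : Measurable fun p : (Fin (n + 1) → ℝ) × ℝ => ENNReal.ofReal
      (resKernel β K (PhiK (n + 1) p.1) (PhiK (n + 1) p.1 - (p.2 + S))) * F₁ (p.2, p.1 0) :=
    ((measurable_resKernel β K).comp ((hΦ.comp measurable_fst).prodMk
        ((hΦ.comp measurable_fst).sub (measurable_snd.add_const S)))).ennreal_ofReal.mul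
      (hF₁.comp (measurable_snd.prodMk ((measurable_pi_apply 0).comp measurable_fst)))
  have hRI : Measurable fun ξ : Fin (n + 1) → ℝ => ∫⁻ σ, ENNReal.ofReal
      (resKernel β K (PhiK (n + 1) ξ) (PhiK (n + 1) ξ - (σ + S))) * F₁ (σ, ξ 0) :=
    hR.lintegral_prod_right'
  have hP : ∀ s : Finset (Fin (n + 2)), Measurable fun ξ : Fin (n + 1) → ℝ =>
      ∏ j ∈ s, HH j ((Fin.cons (∑ i, ξ i) ξ : Fin (n + 2) → ℝ) j) := fun s =>
    Finset.measurable_prod _ fun j _ => (hHm j).comp (hcj j)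
  have hCS := lintegral_sqrt_mul_sqrt_le (μ := (volume : Measure (Fin (n + 1) → ℝ)))
    ((hM'.ennreal_ofReal.mul hRI).mul (hP (Bᶜ.erase 1)))
    ((hM''.ennreal_ofReal.mul ((measurable_invKernel K).comp hΦ).ennreal_ofReal).mul (hP Bᶜᶜ))
  simp only [Pi.mul_apply, Function.comp_apply] at hCS
  refine le_trans (lintegral_mono fun ξ => ?_) (hCS.trans ?_)
  · have hR1 : Measurable fun σ => ENNReal.ofReal
        (resKernel β K (PhiK (n + 1) ξ) (PhiK (n + 1) ξ - (σ + S))) * F₁ (σ, ξ 0) := by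
      simpa only [Function.comp_def] using hR.comp (measurable_prodMk_left (x := ξ))
    have hF1 : Measurable fun σ : ℝ => F₀ (σ + S - PhiK (n + 1) ξ, ∑ i, ξ i) := by fun_prop
    have hin := lintegral_sqrt_mul_sqrt_le (μ := (volume : Measure ℝ)) hF1 hR1
    have htr : ∫⁻ σ, F₀ (σ + S - PhiK (n + 1) ξ, ∑ i, ξ i) = ∫⁻ σ, F₀ (σ, ∑ i, ξ i) := by
      simp only [add_sub_assoc]
      exact lintegral_add_right_eq_self (fun σ => F₀ (σ, ∑ i, ξ i)) _
    rw [htr] at hin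
    have hpe := prod_erase_one_cons n (fun t => ∫⁻ σ, F₀ (σ, t)) 1 H
      (Fin.cons (∑ i, ξ i) ξ : Fin (n + 2) → ℝ)
    rw [← hHH, ← hsplit] at hpe
    simp only [Fin.cons_zero, Fin.cons_succ] at hpe
    have hin2 : (∫⁻ σ, (ENNReal.ofReal (invKernel K (PhiK (n + 1) ξ)) * ENNReal.ofReal
            (resKernel β K (PhiK (n + 1) ξ) (PhiK (n + 1) ξ - (σ + S)))) ^ (1 / 2 : ℝ) *
          F₀ (σ + S - PhiK (n + 1) ξ, ∑ i, ξ i) ^ (1 / 2 : ℝ) * F₁ (σ, ξ 0) ^ (1 / 2 : ℝ)) ≤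
        ENNReal.ofReal (invKernel K (PhiK (n + 1) ξ)) ^ (1 / 2 : ℝ) *
          ((∫⁻ σ, F₀ (σ, ∑ i, ξ i)) ^ (1 / 2 : ℝ) * (∫⁻ σ, ENNReal.ofReal
            (resKernel β K (PhiK (n + 1) ξ) (PhiK (n + 1) ξ - (σ + S))) *
              F₁ (σ, ξ 0)) ^ (1 / 2 : ℝ)) := by
      refine le_trans (le_of_eq ?_) (mul_le_mul_right hin _)
      rw [← lintegral_const_mul _ ((hF1.pow_const _).fun_mul (hR1.pow_const _))]
      refine lintegral_congr fun σ => ?_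
      simp only [mul_rpow_half]
      ring
    refine (mul_le_mul_left (mul_le_mul_right hin2 _) _).trans (le_of_eq ?_)
    rw [prod_rpow_half]
    calc _ = (ENNReal.ofReal (M' ξ) * (∫⁻ σ, ENNReal.ofReal
            (resKernel β K (PhiK (n + 1) ξ) (PhiK (n + 1) ξ - (σ + S))) * F₁ (σ, ξ 0)) *
            (ENNReal.ofReal (M'' ξ) * ENNReal.ofReal (invKernel K (PhiK (n + 1) ξ))) *
            ((∫⁻ σ, F₀ (σ, ∑ i, ξ i)) * ∏ j : Fin n, H j (ξ j.succ))) ^ (1 / 2 : ℝ) := by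
          simp only [mul_rpow_half]
          ring
      _ = _ := by
          rw [← hpe, ← mul_rpow_half]
          congr 1
          ring
  · refine (mul_le_mul' (ENNReal.rpow_le_rpow e1 (by norm_num))
      (ENNReal.rpow_le_rpow e2 (by norm_num))).trans (le_of_eq ?_)
    have hpe : ∏ j ∈ Finset.univ.erase (1 : Fin (n + 2)), ∫⁻ t, HH j t =
        (∫⁻ q, F₀ q) * ∏ j : Fin n, ∫⁻ t, H j t := by
      have := prod_erase_one_cons n (fun _ => ∫⁻ t, ∫⁻ σ, F₀ (σ, t)) (fun _ => ∫⁻ t : ℝ, 1)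
        (fun j _ => ∫⁻ t, H j t) 0
      rw [Measure.volume_eq_prod, lintegral_prod_symm _ hF₀.aemeasurable, ← this]
      refine Finset.prod_congr rfl fun j _ => ?_
      refine Fin.cases ?_ (fun j => Fin.cases ?_ (fun j => ?_) j) j <;> rfl
    rw [← hsplit] at hpe
    rw [prod_rpow_half]
    calc _ = (D * D * (∫⁻ q, F₁ q) * ((∏ j ∈ Bᶜ.erase 1, ∫⁻ t, HH j t) *
          ∏ j ∈ Bᶜᶜ, ∫⁻ t, HH j t)) ^ (1 / 2 : ℝ) := by
          rw [← mul_rpow_half]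
          congr 1
          ring
      _ = _ := by
          rw [hpe]
          simp only [mul_rpow_half, rpow_half_mul_self]
          ring

theorem lintegral_fin_succ (n : ℕ) {f : (Fin (n + 1) → ℝ) → ENNReal} (hf : Measurable f) :
    ∫⁻ σ, f σ = ∫⁻ σ' : Fin n → ℝ, ∫⁻ σ₁ : ℝ, f (Fin.cons σ₁ σ') := by
  have h := (volume_preserving_piFinSuccAbove (fun _ : Fin (n + 1) => ℝ) 0).symm
  rw [← h.lintegral_comp hf, Measure.volume_eq_prod, lintegral_prod_symm
    (fun a => f ((MeasurableEquiv.piFinSuccAbove (fun _ : Fin (n + 1) => ℝ) 0).symm a))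
    (hf.comp h.measurable).aemeasurable]
  refine lintegral_congr fun y => lintegral_congr fun x => congrArg f ?_
  simp [MeasurableEquiv.piFinSuccAbove_symm_apply, Fin.consEquiv]

theorem lintegral_lintegral_fin_succ {X : Type*} [MeasurableSpace X] {μ : Measure X} [SFinite μ]
    (n : ℕ) {E : X × (Fin (n + 1) → ℝ) → ENNReal} (hE : Measurable E) :
    ∫⁻ x, (∫⁻ σ, E (x, σ)) ∂μ =
      ∫⁻ σ' : Fin n → ℝ, ∫⁻ x, (∫⁻ σ₁ : ℝ, E (x, Fin.cons σ₁ σ')) ∂μ := by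
  have hcons : Measurable fun p : (X × (Fin n → ℝ)) × ℝ =>
      E (p.1.1, (Fin.cons p.2 p.1.2 : Fin (n + 1) → ℝ)) := by
    refine hE.comp (measurable_fst.fst.prodMk (measurable_pi_lambda _ fun j => ?_))
    refine Fin.cases ?_ (fun i => ?_) j
    · simp only [Fin.cons_zero]; fun_prop
    · simp only [Fin.cons_succ]; fun_prop
  refine (lintegral_congr fun x => lintegral_fin_succ n (hE.comp measurable_prodMk_left)).trans ?_
  exact lintegral_lintegral_swap hcons.lintegral_prod_right'.aemeasurable

theorem lintegral_univ_prod {ι : Type*} [Fintype ι] [DecidableEq ι] (h : ι → ℝ → ENNReal)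
    (hh : ∀ i, Measurable (h i)) :
    ∫⁻ v : ι → ℝ, ∏ j, h j (v j) = ∏ j, ∫⁻ t, h j t := by
  rw [← lmarginal_prod Finset.univ h hh 0, lmarginal_univ]
  rfl

theorem lintegral_resonance_form_le (n : ℕ) (B : Finset (Fin (n + 2)))
    (hi : (1 : Fin (n + 2)) ∉ B)
    (hB : B.Nonempty) {M' M'' : (Fin (n + 1) → ℝ) → ℝ} (hM' : Measurable M')
    (hM'' : Measurable M'') {β K : ℝ} {D : ENNReal}
    (hD : ∀ α : ℝ, ∀ j₀ ∈ B, ∀ g, ∫⁻ h : {j // j ∈ B.erase j₀} → ℝ,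
      ENNReal.ofReal (M' (tailVec (n + 1) (buildVec (n + 1) B j₀ g h))) *
        ENNReal.ofReal (resKernel β K (PhiFull (n + 1) (buildVec (n + 1) B j₀ g h))
          (PhiFull (n + 1) (buildVec (n + 1) B j₀ g h) - α)) ≤ D)
    (hD' : ∀ j₀ ∈ Bᶜ, ∀ g, ∫⁻ h : {j // j ∈ Bᶜ.erase j₀} → ℝ,
      ENNReal.ofReal (M'' (tailVec (n + 1) (buildVec (n + 1) Bᶜ j₀ g h))) *
        ENNReal.ofReal (invKernel K (PhiFull (n + 1) (buildVec (n + 1) Bᶜ j₀ g h))) ≤ D)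
    {w : ℝ → ENNReal} (hw : Measurable w)
    {F₀ : ℝ × ℝ → ENNReal} (hF₀ : Measurable F₀)
    {F : Fin (n + 1) → ℝ × ℝ → ENNReal} (hF : ∀ j, Measurable (F j)) :
    ∫⁻ ξ : Fin (n + 1) → ℝ, ∫⁻ σ : Fin (n + 1) → ℝ,
        (ENNReal.ofReal (M' ξ) * ENNReal.ofReal (M'' ξ)) ^ (1 / 2 : ℝ) *
        ((ENNReal.ofReal (invKernel K (PhiK (n + 1) ξ)) * ENNReal.ofReal
            (resKernel β K (PhiK (n + 1) ξ) (PhiK (n + 1) ξ - ∑ i, σ i))) ^ (1 / 2 : ℝ) *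
          F₀ (∑ i, σ i - PhiK (n + 1) ξ, ∑ i, ξ i) ^ (1 / 2 : ℝ) *
          F 0 (σ 0, ξ 0) ^ (1 / 2 : ℝ)) *
        ∏ j : Fin n, (w (σ j.succ) * F j.succ (σ j.succ, ξ j.succ)) ^ (1 / 2 : ℝ) ≤
      D * ((∫⁻ t, w t) ^ (1 / 2 : ℝ)) ^ n * (∫⁻ q, F₀ q) ^ (1 / 2 : ℝ) *
        ∏ j, (∫⁻ q, F j q) ^ (1 / 2 : ℝ) := by
  have hΦ := measurable_PhiK (n + 1)
  have hE : Measurable fun p : (Fin (n + 1) → ℝ) × (Fin (n + 1) → ℝ) =>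
      (ENNReal.ofReal (M' p.1) * ENNReal.ofReal (M'' p.1)) ^ (1 / 2 : ℝ) *
        ((ENNReal.ofReal (invKernel K (PhiK (n + 1) p.1)) * ENNReal.ofReal
            (resKernel β K (PhiK (n + 1) p.1) (PhiK (n + 1) p.1 - ∑ i, p.2 i))) ^ (1 / 2 : ℝ) *
          F₀ (∑ i, p.2 i - PhiK (n + 1) p.1, ∑ i, p.1 i) ^ (1 / 2 : ℝ) *
          F 0 (p.2 0, p.1 0) ^ (1 / 2 : ℝ)) *
        ∏ j : Fin n, (w (p.2 j.succ) * F j.succ (p.2 j.succ, p.1 j.succ)) ^ (1 / 2 : ℝ) := by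
    have h1 := measurable_invKernel K
    have h2 := measurable_resKernel β K
    refine ((Measurable.pow_const (by fun_prop) _).mul ((Measurable.mul (Measurable.pow_const
      (Measurable.mul (by fun_prop) (Measurable.ennreal_ofReal ?_)) _)
      (by fun_prop)).mul (by fun_prop))).mul (by fun_prop)
    exact h2.comp (g := fun q : ℝ × ℝ => resKernel β K q.1 q.2)
      (f := fun p : (Fin (n + 1) → ℝ) × (Fin (n + 1) → ℝ) =>
        (PhiK (n + 1) p.1, PhiK (n + 1) p.1 - ∑ i, p.2 i)) (by fun_prop)
  have hswap := lintegral_lintegral_fin_succ n hE (μ := volume)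
  refine le_trans (le_of_eq hswap) ?_
  have hIm : ∀ j : Fin n, Measurable fun y => ∫⁻ t, w y * F j.succ (y, t) := fun j =>
    Measurable.lintegral_prod_right' (f := fun q : ℝ × ℝ => w q.1 * F j.succ q) (by fun_prop)
  calc _ ≤ ∫⁻ σ' : Fin n → ℝ, D * (∫⁻ q, F₀ q) ^ (1 / 2 : ℝ) * (∫⁻ q, F 0 q) ^ (1 / 2 : ℝ) *
        ∏ j : Fin n, (∫⁻ t, w (σ' j) * F j.succ (σ' j, t)) ^ (1 / 2 : ℝ) := by
        refine lintegral_mono fun σ' => ?_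
        refine le_trans (le_of_eq ?_) (lintegral_hyperplane_sqrt_le n B hi hB hM' hM'' hD hD'
          (∑ i, σ' i) hF₀ (hF 0) (H := fun j t => w (σ' j) * F j.succ (σ' j, t))
          (fun j => by fun_prop))
        refine lintegral_congr fun ξ => ?_
        have hm : Measurable fun σ₁ : ℝ =>
            (ENNReal.ofReal (invKernel K (PhiK (n + 1) ξ)) * ENNReal.ofReal (resKernel β K
              (PhiK (n + 1) ξ) (PhiK (n + 1) ξ - (σ₁ + ∑ i, σ' i)))) ^ (1 / 2 : ℝ) *
            F₀ (σ₁ + ∑ i, σ' i - PhiK (n + 1) ξ, ∑ i, ξ i) ^ (1 / 2 : ℝ) *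
            F 0 (σ₁, ξ 0) ^ (1 / 2 : ℝ) := by
          have h2 := (measurable_resKernel β K).comp
            (f := fun σ₁ : ℝ => (PhiK (n + 1) ξ, PhiK (n + 1) ξ - (σ₁ + ∑ i, σ' i))) (by fun_prop)
          exact ((h2.ennreal_ofReal.const_mul _).pow_const _ |>.mul (by fun_prop)).mul (by fun_prop)
        rw [← lintegral_const_mul _ hm, ← lintegral_mul_const _ (hm.const_mul _)]
        simp only [Fin.sum_univ_succ (n := n), Fin.cons_zero, Fin.cons_succ]
    _ ≤ _ := by
        have hm : Measurable fun σ' : Fin n → ℝ =>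
            ∏ j : Fin n, (∫⁻ t, w (σ' j) * F j.succ (σ' j, t)) ^ (1 / 2 : ℝ) :=
          Finset.measurable_prod _ fun j _ => ((hIm j).pow_const _).comp (measurable_pi_apply j)
        rw [lintegral_const_mul _ hm,
          lintegral_univ_prod (fun j y => (∫⁻ t, w y * F j.succ (y, t)) ^ (1 / 2 : ℝ))
            (fun j => (hIm j).pow_const _), Fin.prod_univ_succ]
        have hj : ∀ j : Fin n, ∫⁻ y, (∫⁻ t, w y * F j.succ (y, t)) ^ (1 / 2 : ℝ) ≤
            (∫⁻ t, w t) ^ (1 / 2 : ℝ) * (∫⁻ q, F j.succ q) ^ (1 / 2 : ℝ) := by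
          intro j
          have hm : Measurable fun y => ∫⁻ t, F j.succ (y, t) := (hF j.succ).lintegral_prod_right'
          have := lintegral_sqrt_mul_sqrt_le (μ := (volume : Measure ℝ)) hw hm
          rw [Measure.volume_eq_prod, lintegral_prod _ (hF j.succ).aemeasurable]
          refine le_trans (le_of_eq (lintegral_congr fun y => ?_)) this
          rw [lintegral_const_mul _ (by fun_prop), mul_rpow_half]
        refine (mul_le_mul_right (Finset.prod_le_prod' fun j _ => hj j) _).trans (le_of_eq ?_)
        rw [Finset.prod_mul_distrib, Finset.prod_const, Finset.card_univ, Fintype.card_fin]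
        ring

theorem one_add_sub_sum_sq_le {ι : Type*} (s : Finset ι) (x : ℝ) (y : ι → ℝ) :
    1 + (x - ∑ j ∈ s, y j) ^ 2 ≤ 2 ^ s.card * (1 + x ^ 2) * ∏ j ∈ s, (1 + (y j) ^ 2) := by
  classical
  induction s using Finset.induction_on with
  | empty => simp
  | insert i s hi ih =>
    rw [Finset.sum_insert hi, Finset.prod_insert hi, Finset.card_insert_of_notMem hi]
    set z := x - ∑ j ∈ s, y j with hz
    have h1 : x - (y i + ∑ j ∈ s, y j) = z - y i := by rw [hz]; ring
    have h2 : 1 + (z - y i) ^ 2 ≤ 2 * (1 + z ^ 2) * (1 + (y i) ^ 2) := by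
      nlinarith [sq_nonneg (z + y i), sq_nonneg (z * y i)]
    rw [h1]
    calc _ ≤ 2 * (1 + z ^ 2) * (1 + (y i) ^ 2) := h2
      _ ≤ 2 * (2 ^ s.card * (1 + x ^ 2) * ∏ j ∈ s, (1 + (y j) ^ 2)) * (1 + (y i) ^ 2) := by gcongr
      _ = _ := by ring

theorem modulation_weight_le (n : ℕ) {β b : ℝ} (hβ : 0 < β) (hβ1 : β ≤ 1) (σ : Fin (n + 1) → ℝ)
    (φ : ℝ) :
    (1 + (∑ i, σ i - φ) ^ 2) ^ (-(β / 2)) * ((1 + (σ 0) ^ 2) ^ (β / 2) *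
        ∏ j : Fin n, (1 + (σ j.succ) ^ 2) ^ (-(b / 2))) ≤
      (2 ^ (n + 1)) ^ (β / 2) * ((1 + |φ| ^ β * (1 + (φ - ∑ i, σ i) ^ 2) ^ (-(β / 2))) *
        ∏ j : Fin n, (1 + (σ j.succ) ^ 2) ^ (-((b - β) / 2))) := by
  set z := ∑ i, σ i - φ with hz
  have hz' : (φ - ∑ i, σ i) ^ 2 = z ^ 2 := by rw [hz]; ring
  have h0 : σ 0 = z + φ - ∑ j : Fin n, σ j.succ := by
    rw [hz, Fin.sum_univ_succ]; ring
  have h1 := one_add_sub_sum_sq_le Finset.univ (z + φ) fun j : Fin n => σ j.succ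
  rw [← h0, Finset.card_univ, Fintype.card_fin] at h1
  have h2 : 1 + (z + φ) ^ 2 ≤ 2 * (1 + z ^ 2 + φ ^ 2) := by nlinarith [sq_nonneg (z - φ)]
  have hP : (0 : ℝ) ≤ ∏ j : Fin n, (1 + (σ j.succ) ^ 2) :=
    Finset.prod_nonneg fun j _ => by positivity
  have h3 : 1 + (σ 0) ^ 2 ≤ 2 ^ (n + 1) * ((1 + z ^ 2 + φ ^ 2) *
      ∏ j : Fin n, (1 + (σ j.succ) ^ 2)) := by
    calc _ ≤ _ := h1
      _ ≤ 2 ^ n * (2 * (1 + z ^ 2 + φ ^ 2)) * ∏ j : Fin n, (1 + (σ j.succ) ^ 2) := by gcongr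
      _ = _ := by ring
  have h4 : (1 + z ^ 2 + φ ^ 2) ^ (β / 2) ≤ (1 + z ^ 2) ^ (β / 2) + |φ| ^ β := by
    refine (Real.rpow_add_le_add_rpow (by positivity) (by positivity) (by positivity)
      (by linarith)).trans (le_of_eq ?_)
    rw [← sq_abs φ, ← Real.rpow_natCast_mul (abs_nonneg φ)]
    congr 2
    push_cast; ring
  have h5 : (1 + (σ 0) ^ 2) ^ (β / 2) ≤ (2 ^ (n + 1)) ^ (β / 2) *
      (((1 + z ^ 2) ^ (β / 2) + |φ| ^ β) * ∏ j : Fin n, (1 + (σ j.succ) ^ 2) ^ (β / 2)) := by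
    refine (Real.rpow_le_rpow (by positivity) h3 (by positivity)).trans ?_
    rw [Real.mul_rpow (by positivity) (by positivity), Real.mul_rpow (by positivity) hP,
      Real.finsetProd_rpow _ _ fun j _ => by positivity]
    gcongr
  have hQ : ∀ j : Fin n, (0 : ℝ) ≤ (1 + (σ j.succ) ^ 2) ^ (-(b / 2)) := fun j => by positivity
  rw [hz']
  calc _ ≤ (1 + z ^ 2) ^ (-(β / 2)) * ((2 ^ (n + 1)) ^ (β / 2) *
      (((1 + z ^ 2) ^ (β / 2) + |φ| ^ β) * ∏ j : Fin n, (1 + (σ j.succ) ^ 2) ^ (β / 2)) *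
        ∏ j : Fin n, (1 + (σ j.succ) ^ 2) ^ (-(b / 2))) := by
        have := Finset.prod_nonneg fun (j : Fin n) (_ : j ∈ Finset.univ) => hQ j
        gcongr
    _ = (2 ^ (n + 1)) ^ (β / 2) * (((1 + z ^ 2) ^ (β / 2) * (1 + z ^ 2) ^ (-(β / 2)) +
        |φ| ^ β * (1 + z ^ 2) ^ (-(β / 2))) * ∏ j : Fin n, ((1 + (σ j.succ) ^ 2) ^ (β / 2) *
          (1 + (σ j.succ) ^ 2) ^ (-(b / 2)))) := by
        rw [Finset.prod_mul_distrib]; ring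
    _ = _ := by
        rw [← Real.rpow_add (by positivity), add_neg_cancel, Real.rpow_zero]
        congr 2
        refine Finset.prod_congr rfl fun j _ => ?_
        rw [← Real.rpow_add (by positivity)]
        congr 1
        ring

theorem padTot_eq_snoc (n : ℕ) (tot : ℝ) (v : Fin n → ℝ) :
    padTot (n + 1) tot v = Fin.snoc v (tot - ∑ i, v i) := by
  ext j
  refine Fin.lastCases ?_ (fun i => ?_) j
  · simp [padTot]
  · simp [padTot]

theorem measurable_padTot (n : ℕ) :
    Measurable fun p : ℝ × (Fin n → ℝ) => padTot (n + 1) p.1 p.2 := by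
  refine measurable_pi_lambda _ fun j => ?_
  simp only [padTot_eq_snoc]
  refine Fin.lastCases ?_ (fun i => ?_) j
  · simp only [Fin.snoc_last]; fun_prop
  · simp only [Fin.snoc_castSucc]; fun_prop

theorem lintegral_padTot (n : ℕ) {f : (Fin (n + 1) → ℝ) → ENNReal} (hf : Measurable f) :
    ∫⁻ tot : ℝ, ∫⁻ v : Fin n → ℝ, f (padTot (n + 1) tot v) = ∫⁻ ξ, f ξ := by
  have h := (volume_preserving_piFinSuccAbove (fun _ : Fin (n + 1) => ℝ) (Fin.last n)).symm
  rw [lintegral_lintegral_swap (f := fun tot (v : Fin n → ℝ) => f (padTot (n + 1) tot v))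
    (hf.comp (measurable_padTot n)).aemeasurable, ← h.lintegral_comp hf,
    Measure.volume_eq_prod, lintegral_prod_symm
    (fun a => f ((MeasurableEquiv.piFinSuccAbove (fun _ : Fin (n + 1) => ℝ) (Fin.last n)).symm a))
    (hf.comp h.measurable).aemeasurable]
  refine lintegral_congr fun v => ?_
  refine Eq.trans ?_ (lintegral_sub_right_eq_self (fun x => f ((MeasurableEquiv.piFinSuccAbove
    (fun _ : Fin (n + 1) => ℝ) (Fin.last n)).symm (x, v))) (∑ i, v i))
  refine lintegral_congr fun x => congrArg f ?_
  rw [padTot_eq_snoc]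
  simp [MeasurableEquiv.piFinSuccAbove_symm_apply, Fin.snocEquiv]

theorem lintegral_padTot_prod (n : ℕ) {E : (Fin (n + 1) → ℝ) × (Fin (n + 1) → ℝ) → ENNReal}
    (hE : Measurable E) :
    ∫⁻ q : ℝ × ℝ, ∫⁻ p : Fin n → ℝ × ℝ, E (padTot (n + 1) q.1 (fun i => (p i).1),
        padTot (n + 1) q.2 (fun i => (p i).2)) =
      ∫⁻ ξ : Fin (n + 1) → ℝ, ∫⁻ σ : Fin (n + 1) → ℝ, E (fun j => σ j + (ξ j) ^ 3, ξ) := by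
  have hpad := measurable_padTot n
  have hsplit : ∀ q : ℝ × ℝ, ∫⁻ p : Fin n → ℝ × ℝ, E (padTot (n + 1) q.1 (fun i => (p i).1),
        padTot (n + 1) q.2 (fun i => (p i).2)) =
      ∫⁻ w : Fin n → ℝ, ∫⁻ v : Fin n → ℝ, E (padTot (n + 1) q.1 v, padTot (n + 1) q.2 w) := by
    intro q
    have hm : Measurable fun r : (Fin n → ℝ) × (Fin n → ℝ) =>
        E (padTot (n + 1) q.1 r.1, padTot (n + 1) q.2 r.2) :=
      hE.comp ((hpad.comp (measurable_const.prodMk measurable_fst)).prodMk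
        (hpad.comp (measurable_const.prodMk measurable_snd)))
    have h := (volume_measurePreserving_arrowProdEquivProdArrow ℝ ℝ (Fin n)).lintegral_comp hm
    rw [Measure.volume_eq_prod, lintegral_prod_symm _ hm.aemeasurable] at h
    exact h
  have hm4 : Measurable fun r : (ℝ × ℝ) × ((Fin n → ℝ) × (Fin n → ℝ)) =>
      E (padTot (n + 1) r.1.1 r.2.2, padTot (n + 1) r.1.2 r.2.1) :=
    hE.comp ((hpad.comp (by fun_prop : Measurable fun r : (ℝ × ℝ) × ((Fin n → ℝ) × (Fin n → ℝ)) =>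
      (r.1.1, r.2.2))).prodMk (hpad.comp (by fun_prop : Measurable fun r :
        (ℝ × ℝ) × ((Fin n → ℝ) × (Fin n → ℝ)) => (r.1.2, r.2.1))))
  have hm3 : Measurable fun r : (ℝ × ℝ) × (Fin n → ℝ) =>
      ∫⁻ v : Fin n → ℝ, E (padTot (n + 1) r.1.1 v, padTot (n + 1) r.1.2 r.2) :=
    Measurable.lintegral_prod_right' (f := fun s : ((ℝ × ℝ) × (Fin n → ℝ)) × (Fin n → ℝ) =>
      E (padTot (n + 1) s.1.1.1 s.2, padTot (n + 1) s.1.1.2 s.1.2))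
      (hm4.comp (by fun_prop : Measurable fun s : ((ℝ × ℝ) × (Fin n → ℝ)) × (Fin n → ℝ) =>
        (s.1.1, (s.1.2, s.2))))
  have hm2 : Measurable fun q : ℝ × ℝ => ∫⁻ w : Fin n → ℝ, ∫⁻ v : Fin n → ℝ,
      E (padTot (n + 1) q.1 v, padTot (n + 1) q.2 w) := hm3.lintegral_prod_right'
  have hI : Measurable fun ξ : Fin (n + 1) → ℝ => ∫⁻ τ, E (τ, ξ) := hE.lintegral_prod_left'
  rw [lintegral_congr hsplit, Measure.volume_eq_prod, lintegral_prod_symm _ hm2.aemeasurable]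
  calc _ = ∫⁻ y : ℝ, ∫⁻ w : Fin n → ℝ, ∫⁻ x : ℝ, ∫⁻ v : Fin n → ℝ,
        E (padTot (n + 1) x v, padTot (n + 1) y w) := by
        refine lintegral_congr fun y => lintegral_lintegral_swap (Measurable.aemeasurable ?_)
        exact hm3.comp (by fun_prop : Measurable fun r : ℝ × (Fin n → ℝ) => ((r.1, y), r.2))
    _ = ∫⁻ y : ℝ, ∫⁻ w : Fin n → ℝ, ∫⁻ τ, E (τ, padTot (n + 1) y w) :=
        lintegral_congr fun y => lintegral_congr fun w =>
          lintegral_padTot n (f := fun τ => E (τ, padTot (n + 1) y w)) (by fun_prop)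
    _ = ∫⁻ ξ, ∫⁻ τ, E (τ, ξ) := lintegral_padTot n hI
    _ = _ := lintegral_congr fun ξ =>
        (lintegral_add_right_eq_self (fun τ => E (τ, ξ)) fun j => (ξ j) ^ 3).symm

/-- The converse of the Cauchy-Schwarz inequality, with test functions written as `G ^ (1 / 2)`. -/
theorem lintegral_sq_le_of_forall {X : Type*} [MeasurableSpace X] {μ : Measure X} [SigmaFinite μ]
    {h : X → ENNReal} {D : ENNReal}
    (H : ∀ G : X → ENNReal, Measurable G →
      ∫⁻ x, G x ^ (1 / 2 : ℝ) * h x ∂μ ≤ D * (∫⁻ x, G x ∂μ) ^ (1 / 2 : ℝ)) :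
    ∫⁻ x, h x ^ 2 ∂μ ≤ D ^ 2 := by
  by_contra! hlt
  simp_rw [lintegral_eq_nnreal, lt_iSup_iff] at hlt
  obtain ⟨g₀, hg₀, g₀L⟩ := hlt
  have h'L : D ^ 2 < ∫⁻ x, g₀ x ∂μ := by
    convert! g₀L
    rw [← SimpleFunc.lintegral_eq_lintegral, SimpleFunc.coe_map]
    simp only [Function.comp_apply]
  obtain ⟨g, hg, gtop, gL⟩ := SimpleFunc.exists_lt_lintegral_simpleFunc_of_lt_lintegral h'L
  refine absurd gL (not_lt.2 ?_)
  set I := ∫⁻ x, (g x : ENNReal) ∂μ with hI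
  have h1 : I ≤ D * I ^ (1 / 2 : ℝ) := by
    refine le_trans (lintegral_mono fun x => ?_) (H (fun x => (g x : ENNReal))
      g.measurable.coe_nnreal_ennreal)
    calc ((g x : ENNReal)) = (g x : ENNReal) ^ (1 / 2 : ℝ) * (g x : ENNReal) ^ (1 / 2 : ℝ) :=
          (rpow_half_mul_self _).symm
      _ ≤ (g x : ENNReal) ^ (1 / 2 : ℝ) * (h x ^ 2) ^ (1 / 2 : ℝ) := by
          gcongr
          exact (ENNReal.coe_le_coe.2 (hg x)).trans (hg₀ x)
      _ = _ := by rw [sq_rpow_half]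
  by_cases h0 : I = 0
  · simp [h0]
  have h2 : I ^ (1 / 2 : ℝ) ≤ D := by
    have hI0 : I ^ (1 / 2 : ℝ) ≠ 0 := by simp [h0]
    have hIt : I ^ (1 / 2 : ℝ) ≠ ⊤ := ENNReal.rpow_ne_top_of_nonneg (by norm_num) gtop.ne
    exact (ENNReal.mul_le_mul_iff_left hI0 hIt).1 ((rpow_half_mul_self I).le.trans h1)
  calc I = (I ^ (1 / 2 : ℝ)) ^ 2 := (rpow_half_sq I).symm
    _ ≤ D ^ 2 := by gcongr

theorem ofReal_rpow_half {x : ℝ} (hx : 0 ≤ x) :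
    ENNReal.ofReal x ^ (1 / 2 : ℝ) = ENNReal.ofReal √x := by
  rw [ENNReal.ofReal_rpow_of_nonneg hx (by norm_num), Real.sqrt_eq_rpow]

theorem sqrt_rpow {x : ℝ} (hx : 0 ≤ x) (s : ℝ) : √(x ^ s) = x ^ (s / 2) := by
  rw [Real.sqrt_eq_rpow, ← Real.rpow_mul hx, mul_one_div]

theorem sqrt_wgt (s b σ ξ : ℝ) :
    √(wgt s b (σ + ξ ^ 3) ξ) = (1 + ξ ^ 2) ^ (s / 2) * (1 + σ ^ 2) ^ (b / 2) := by
  rw [wgt, add_sub_cancel_right, Real.sqrt_mul (by positivity), sqrt_rpow (by positivity),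
    sqrt_rpow (by positivity)]

/-- Pointwise domination of the symbol by the resonance weights and the Bourgain weights. -/
theorem multiplier_weight_le (n : ℕ) {β b : ℝ} (hβ : 0 < β) (hβ1 : β ≤ 1) (s : ℝ)
    (sv : Fin (n + 1) → ℝ) {K : ℝ} (ξ σ : Fin (n + 1) → ℝ) {m Q : ℝ} (hQ0 : 0 ≤ Q)
    (hQ : Q = m * (1 + (∑ j, ξ j) ^ 2) ^ (s / 2) / ∏ j, (1 + (ξ j) ^ 2) ^ (sv j / 2)) :
    √(wgt s (-β) (∑ j, (σ j + (ξ j) ^ 3)) (∑ j, ξ j)) * (m * invKernel K (PhiK (n + 1) ξ)) ≤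
      (2 ^ (n + 1)) ^ (β / 2) * (Q * (√(invKernel K (PhiK (n + 1) ξ) *
        resKernel β K (PhiK (n + 1) ξ) (PhiK (n + 1) ξ - ∑ i, σ i)) *
        √(wgt (sv 0) (-β) (σ 0 + (ξ 0) ^ 3) (ξ 0))) *
        ∏ j : Fin n, (√((1 + (σ j.succ) ^ 2) ^ (-(b - β))) *
          √(wgt (sv j.succ) b (σ j.succ + (ξ j.succ) ^ 3) (ξ j.succ)))) := by
  set φ := PhiK (n + 1) ξ with hφ
  by_cases hK : K < |φ|
  swap
  · simp [invKernel, hK]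
  have hτ : ∑ j, (σ j + (ξ j) ^ 3) = (∑ j, σ j - φ) + (∑ j, ξ j) ^ 3 := by
    rw [Finset.sum_add_distrib, hφ, PhiK]; ring
  have hmod := modulation_weight_le n (b := b) hβ hβ1 σ φ
  have hX : 0 ≤ |φ| ^ β * (1 + (φ - ∑ i, σ i) ^ 2) ^ (-(β / 2)) := by positivity
  have hsq : √(invKernel K φ * resKernel β K φ (φ - ∑ i, σ i)) =
      |φ|⁻¹ * (1 + |φ| ^ β * (1 + (φ - ∑ i, σ i) ^ 2) ^ (-(β / 2))) := by
    rw [invKernel, resKernel, if_pos hK, if_pos hK, ← mul_assoc, ← sq, ← mul_pow,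
      Real.sqrt_sq (by positivity)]
  rw [hτ, hsq, sqrt_wgt]
  simp only [sqrt_wgt]
  rw [invKernel, if_pos hK]
  have hs : ∀ j : Fin n, √((1 + (σ j.succ) ^ 2) ^ (-(b - β))) =
      (1 + (σ j.succ) ^ 2) ^ (-((b - β) / 2)) := fun j => by
    rw [sqrt_rpow (by positivity)]; congr 1; ring
  simp only [hs, Finset.prod_mul_distrib]
  have hP : 0 < ∏ j, (1 + (ξ j) ^ 2) ^ (sv j / 2) := Finset.prod_pos fun j _ => by positivity
  have hm : m * (1 + (∑ j, ξ j) ^ 2) ^ (s / 2) = Q * ∏ j, (1 + (ξ j) ^ 2) ^ (sv j / 2) := by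
    rw [hQ]; field_simp
  rw [Fin.prod_univ_succ] at hm hP
  set P₁ := ∏ j : Fin n, (1 + (ξ j.succ) ^ 2) ^ (sv j.succ / 2)
  set Γ := ∏ j : Fin n, (1 + (σ j.succ) ^ 2) ^ (-((b - β) / 2))
  set X := |φ| ^ β * (1 + (φ - ∑ i, σ i) ^ 2) ^ (-(β / 2))
  have hneg : ∀ x c : ℝ, (1 + x ^ 2) ^ (c / 2) * (1 + x ^ 2) ^ (-(c / 2)) = 1 := fun x c => by
    rw [← Real.rpow_add (by positivity), add_neg_cancel, Real.rpow_zero]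
  have hR : (∏ j : Fin n, (1 + (σ j.succ) ^ 2) ^ (b / 2)) *
      ∏ j : Fin n, (1 + (σ j.succ) ^ 2) ^ (-(b / 2)) = 1 := by
    rw [← Finset.prod_mul_distrib]
    exact Finset.prod_eq_one fun j _ => hneg _ _
  have hR0 := hneg (σ 0) β
  have hRn : 0 ≤ ∏ j : Fin n, (1 + (σ j.succ) ^ 2) ^ (b / 2) :=
    Finset.prod_nonneg fun j _ => by positivity
  have hRn0 : 0 ≤ (1 + (σ 0) ^ 2) ^ (-(β / 2)) := by positivity
  simp only [neg_div]
  set R := ∏ j : Fin n, (1 + (σ j.succ) ^ 2) ^ (b / 2)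
  set R' := ∏ j : Fin n, (1 + (σ j.succ) ^ 2) ^ (-(b / 2))
  set r := (1 + (σ 0) ^ 2) ^ (-(β / 2))
  set r' := (1 + (σ 0) ^ 2) ^ (β / 2)
  set z := (1 + (∑ j, σ j - φ) ^ 2) ^ (-(β / 2))
  set p := (1 + (ξ 0) ^ 2) ^ (sv 0 / 2)
  set C : ℝ := (2 ^ (n + 1)) ^ (β / 2)
  have hz : z ≤ C * ((1 + X) * Γ) * (r * R) := by
    calc z = z * (r' * R') * (r * R) := by linear_combination (-z * R * R') * hR0 - z * hR
      _ ≤ _ := by gcongr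
  calc _ = Q * |φ|⁻¹ * (p * P₁) * z := by linear_combination (z * |φ|⁻¹) * hm
    _ ≤ Q * |φ|⁻¹ * (p * P₁) * (C * ((1 + X) * Γ) * (r * R)) := by gcongr
    _ = _ := by ring

theorem sum_padTot (n : ℕ) (tot : ℝ) (v : Fin n → ℝ) : ∑ j, padTot (n + 1) tot v j = tot := by
  rw [padTot_eq_snoc, Fin.sum_univ_castSucc]
  simp

theorem lintegral_shear {g : ℝ × ℝ → ENNReal} (hg : Measurable g) :
    ∫⁻ q : ℝ × ℝ, g (q.1 + q.2 ^ 3, q.2) = ∫⁻ q, g q := by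
  have h : Measurable fun q : ℝ × ℝ => g (q.1 + q.2 ^ 3, q.2) := by fun_prop
  rw [Measure.volume_eq_prod, lintegral_prod_symm _ h.aemeasurable,
    lintegral_prod_symm _ hg.aemeasurable]
  exact lintegral_congr fun t => lintegral_add_right_eq_self (fun y => g (y, t)) (t ^ 3)

theorem measurable_wgt (s b : ℝ) : Measurable fun q : ℝ × ℝ => wgt s b q.1 q.2 := by
  unfold wgt; fun_prop

theorem ofReal_mul_prod_mul {n : ℕ} {a q x y : ℝ} {u v : Fin n → ℝ} (ha : 0 ≤ a) (hq : 0 ≤ q)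
    (hx : 0 ≤ x) (hy : 0 ≤ y) (hu : ∀ j, 0 ≤ u j) (hv : ∀ j, 0 ≤ v j) :
    ENNReal.ofReal (a * (q * (x * y) * ∏ j, (u j * v j))) =
      ENNReal.ofReal a * (ENNReal.ofReal q * (ENNReal.ofReal x * ENNReal.ofReal y) *
        ((∏ j, ENNReal.ofReal (u j)) * ∏ j, ENNReal.ofReal (v j))) := by
  rw [ENNReal.ofReal_mul ha, ENNReal.ofReal_mul (by positivity), ENNReal.ofReal_mul hq,
    ENNReal.ofReal_mul hx, ENNReal.ofReal_prod_of_nonneg fun j _ => mul_nonneg (hu j) (hv j),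
    ← Finset.prod_mul_distrib]
  congr 2
  exact Finset.prod_congr rfl fun j _ => ENNReal.ofReal_mul (hu j)

/-- The weighted multilinear estimate for nonnegative functions on the Fourier side. -/
theorem lintegral_wgt_mul_sq_le (n : ℕ) (B : Finset (Fin (n + 2)))
    (hi : (1 : Fin (n + 2)) ∉ B)
    (hB : B.Nonempty) {M' M'' m : (Fin (n + 1) → ℝ) → ℝ} (hM' : Measurable M')
    (hM'' : Measurable M'') (hM'0 : ∀ ξ, 0 ≤ M' ξ) (hM''0 : ∀ ξ, 0 ≤ M'' ξ) (hm : Measurable m)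
    {β b s K : ℝ} {sv : Fin (n + 1) → ℝ} (hβ : 0 < β) (hβ1 : β ≤ 1) {D : ENNReal}
    (hD : ∀ α : ℝ, ∀ j₀ ∈ B, ∀ g, ∫⁻ h : {j // j ∈ B.erase j₀} → ℝ,
      ENNReal.ofReal (M' (tailVec (n + 1) (buildVec (n + 1) B j₀ g h))) *
        ENNReal.ofReal (resKernel β K (PhiFull (n + 1) (buildVec (n + 1) B j₀ g h))
          (PhiFull (n + 1) (buildVec (n + 1) B j₀ g h) - α)) ≤ D)
    (hD' : ∀ j₀ ∈ Bᶜ, ∀ g, ∫⁻ h : {j // j ∈ Bᶜ.erase j₀} → ℝ,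
      ENNReal.ofReal (M'' (tailVec (n + 1) (buildVec (n + 1) Bᶜ j₀ g h))) *
        ENNReal.ofReal (invKernel K (PhiFull (n + 1) (buildVec (n + 1) Bᶜ j₀ g h))) ≤ D)
    (hQ : ∀ ξ, √(M' ξ * M'' ξ) =
      m ξ * (1 + (∑ j, ξ j) ^ 2) ^ (s / 2) / ∏ j, (1 + (ξ j) ^ 2) ^ (sv j / 2))
    {f : Fin (n + 1) → ℝ × ℝ → ENNReal} (hf : ∀ j, Measurable (f j)) :
    ∫⁻ q : ℝ × ℝ, ENNReal.ofReal (wgt s (-β) q.1 q.2) * (∫⁻ p : Fin n → ℝ × ℝ,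
        ENNReal.ofReal (m (padTot (n + 1) q.2 fun i => (p i).2) *
          invKernel K (PhiK (n + 1) (padTot (n + 1) q.2 fun i => (p i).2))) *
        ∏ j, f j (padTot (n + 1) q.1 (fun i => (p i).1) j,
          padTot (n + 1) q.2 (fun i => (p i).2) j)) ^ 2 ≤
      (ENNReal.ofReal ((2 ^ (n + 1)) ^ (β / 2)) * (D *
        ((∫⁻ t : ℝ, ENNReal.ofReal ((1 + t ^ 2) ^ (-(b - β)))) ^ (1 / 2 : ℝ)) ^ n *
        ((∫⁻ q, ENNReal.ofReal (wgt (sv 0) (-β) q.1 q.2) * f 0 q ^ 2) ^ (1 / 2 : ℝ) *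
          ∏ j : Fin n, (∫⁻ q, ENNReal.ofReal (wgt (sv j.succ) b q.1 q.2) *
            f j.succ q ^ 2) ^ (1 / 2 : ℝ)))) ^ 2 := by
  set W := ((∫⁻ t : ℝ, ENNReal.ofReal ((1 + t ^ 2) ^ (-(b - β)))) ^ (1 / 2 : ℝ)) ^ n with hW
  have hinv := measurable_invKernel K
  have hΦ := measurable_PhiK (n + 1)
  have hsq : ∀ q : ℝ × ℝ, ∀ T : ENNReal, ENNReal.ofReal (wgt s (-β) q.1 q.2) * T ^ 2 =
      (ENNReal.ofReal √(wgt s (-β) q.1 q.2) * T) ^ 2 := fun q T => by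
    rw [mul_pow, ← ENNReal.ofReal_pow (Real.sqrt_nonneg _), Real.sq_sqrt (wgt_nonneg _ _ _ _)]
  simp only [hsq]
  refine lintegral_sq_le_of_forall fun G hG => ?_
  let bb : Fin (n + 1) → ℝ := Fin.cons (-β) fun _ => b
  let H : Fin (n + 1) → ℝ × ℝ → ENNReal := fun j q =>
    ENNReal.ofReal (wgt (sv j) (bb j) q.1 q.2) * f j q ^ 2
  have hH : ∀ j, Measurable (H j) := fun j =>
    (measurable_wgt _ _).ennreal_ofReal.mul ((hf j).pow_const 2)
  have hform := lintegral_resonance_form_le n B hi hB hM' hM'' hD hD'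
    (w := fun t => ENNReal.ofReal ((1 + t ^ 2) ^ (-(b - β)))) (by fun_prop)
    (F₀ := fun q => G (q.1 + q.2 ^ 3, q.2)) (by fun_prop)
    (F := fun j q => H j (q.1 + q.2 ^ 3, q.2)) (fun j => by have := hH j; fun_prop)
  rw [lintegral_shear hG] at hform
  simp only [fun j => lintegral_shear (hH j)] at hform
  rw [← hW] at hform
  have hHr : ∀ j q, H j q ^ (1 / 2 : ℝ) =
      ENNReal.ofReal √(wgt (sv j) (bb j) q.1 q.2) * f j q := fun j q => by
    rw [mul_rpow_half, sq_rpow_half, ofReal_rpow_half (wgt_nonneg _ _ _ _)]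
  let E : (Fin (n + 1) → ℝ) × (Fin (n + 1) → ℝ) → ENNReal := fun r =>
    G (∑ j, r.1 j, ∑ j, r.2 j) ^ (1 / 2 : ℝ) *
      (ENNReal.ofReal √(wgt s (-β) (∑ j, r.1 j) (∑ j, r.2 j)) *
        (ENNReal.ofReal (m r.2 * invKernel K (PhiK (n + 1) r.2)) *
          ∏ j, f j (r.1 j, r.2 j)))
  have hE : Measurable E := by
    have hw := (measurable_wgt s (-β)).comp
      (f := fun r : (Fin (n + 1) → ℝ) × (Fin (n + 1) → ℝ) => (∑ j, r.1 j, ∑ j, r.2 j))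
      (by fun_prop)
    refine Measurable.mul (by fun_prop) (hw.sqrt.ennreal_ofReal.mul
      (Measurable.mul (by fun_prop) (by fun_prop)))
  calc _ ≤ ∫⁻ q : ℝ × ℝ, ∫⁻ p : Fin n → ℝ × ℝ, E (padTot (n + 1) q.1 (fun i => (p i).1),
        padTot (n + 1) q.2 (fun i => (p i).2)) := by
        refine lintegral_mono fun q => ?_
        rw [← mul_assoc]
        refine (lintegral_const_mul_le _ _).trans (le_of_eq (lintegral_congr fun p => ?_))
        simp only [E, sum_padTot, mul_assoc]
    _ = ∫⁻ ξ : Fin (n + 1) → ℝ, ∫⁻ σ : Fin (n + 1) → ℝ, E (fun j => σ j + (ξ j) ^ 3, ξ) :=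
        lintegral_padTot_prod n hE
    _ ≤ ENNReal.ofReal ((2 ^ (n + 1)) ^ (β / 2)) * _ := by
        refine le_trans ?_ (mul_le_mul_right hform _)
        rw [← lintegral_const_mul' _ _ ENNReal.ofReal_ne_top]
        refine lintegral_mono fun ξ => ?_
        rw [← lintegral_const_mul' _ _ ENNReal.ofReal_ne_top]
        refine lintegral_mono fun σ => ?_
        have hmul := ENNReal.ofReal_le_ofReal (multiplier_weight_le n (b := b) (K := K) hβ hβ1 s sv
          ξ σ (Real.sqrt_nonneg _) (hQ ξ))
        rw [ENNReal.ofReal_mul (Real.sqrt_nonneg _), ofReal_mul_prod_mul (by positivity)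
          (Real.sqrt_nonneg _) (Real.sqrt_nonneg _) (Real.sqrt_nonneg _)
          (fun j => Real.sqrt_nonneg _) fun j => Real.sqrt_nonneg _] at hmul
        have hτ : ∑ j, (σ j + (ξ j) ^ 3) = (∑ j, σ j - PhiK (n + 1) ξ) + (∑ j, ξ j) ^ 3 := by
          rw [Finset.sum_add_distrib, PhiK]; ring
        have hinv0 : 0 ≤ invKernel K (PhiK (n + 1) ξ) := by
          unfold invKernel; split_ifs <;> positivity
        have hM : (ENNReal.ofReal (M' ξ) * ENNReal.ofReal (M'' ξ)) ^ (1 / 2 : ℝ) =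
            ENNReal.ofReal √(M' ξ * M'' ξ) := by
          rw [← ENNReal.ofReal_mul (hM'0 ξ), ofReal_rpow_half (mul_nonneg (hM'0 ξ) (hM''0 ξ))]
        have hR : (ENNReal.ofReal (invKernel K (PhiK (n + 1) ξ)) * ENNReal.ofReal
            (resKernel β K (PhiK (n + 1) ξ) (PhiK (n + 1) ξ - ∑ i, σ i))) ^ (1 / 2 : ℝ) =
            ENNReal.ofReal √(invKernel K (PhiK (n + 1) ξ) *
              resKernel β K (PhiK (n + 1) ξ) (PhiK (n + 1) ξ - ∑ i, σ i)) := by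
          rw [← ENNReal.ofReal_mul hinv0, ofReal_rpow_half (mul_nonneg hinv0
            (hinv0.trans (invKernel_le_resKernel _ _ _ _)))]
        have hb0 : bb 0 = -β := rfl
        have hbs : ∀ j : Fin n, bb j.succ = b := fun j => rfl
        have hw : ∀ t : ℝ, ENNReal.ofReal ((1 + t ^ 2) ^ (-(b - β))) ^ (1 / 2 : ℝ) =
            ENNReal.ofReal √((1 + t ^ 2) ^ (-(b - β))) := fun t =>
          ofReal_rpow_half (by positivity)
        rw [hM, hR, ← hτ]
        simp only [mul_rpow_half, hHr, hb0, hbs, hw]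
        simp only [Finset.prod_mul_distrib]
        calc _ = G (∑ j, (σ j + ξ j ^ 3), ∑ j, ξ j) ^ (1 / 2 : ℝ) * ((∏ j, f j (σ j + ξ j ^ 3, ξ j)) *
              (ENNReal.ofReal √(wgt s (-β) (∑ j, (σ j + ξ j ^ 3)) (∑ j, ξ j)) *
                ENNReal.ofReal (m ξ * invKernel K (PhiK (n + 1) ξ)))) := by
              simp only [E]; ring
          _ ≤ G (∑ j, (σ j + ξ j ^ 3), ∑ j, ξ j) ^ (1 / 2 : ℝ) *
              ((∏ j, f j (σ j + ξ j ^ 3, ξ j)) * _) := mul_le_mul_right (mul_le_mul_right hmul _) _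
          _ = _ := by
              rw [Fin.prod_univ_succ]
              ring
    _ = _ := by
        rw [Fin.prod_univ_succ]
        simp only [H, bb, Fin.cons_zero, Fin.cons_succ]
        ring

theorem lintegral_wgt_mul_FT2_rpow (s b : ℝ) (u : SchwartzMap (ℝ × ℝ) ℂ) :
    (∫⁻ q : ℝ × ℝ, ENNReal.ofReal (wgt s b q.1 q.2) * ‖FT2 u q.1 q.2‖ₑ ^ 2) ^ (1 / 2 : ℝ) =
      ENNReal.ofReal (Xnorm s b u) := by
  have h0 : ∀ q : ℝ × ℝ, 0 ≤ wgt s b q.1 q.2 * ‖FT2 u q.1 q.2‖ ^ 2 := fun q =>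
    mul_nonneg (wgt_nonneg _ _ _ _) (sq_nonneg _)
  rw [Xnorm, ← ofReal_rpow_half (integral_nonneg h0),
    ofReal_integral_eq_lintegral_ofReal (integrable_wgt_mul_FT2 s b u) (.of_forall h0)]
  congr 2 with q
  rw [ENNReal.ofReal_mul (wgt_nonneg _ _ _ _), ENNReal.ofReal_pow (norm_nonneg _), ofReal_norm]

theorem XnormM_le {s b R : ℝ} {k : ℕ} {M : (Fin k → ℝ) → ℂ} {u : Fin k → ℝ × ℝ → ℂ} (hR : 0 ≤ R)
    (h : ∫⁻ q : ℝ × ℝ, ENNReal.ofReal (wgt s b q.1 q.2) * ‖convFT k M u q.1 q.2‖ₑ ^ 2 ≤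
      ENNReal.ofReal R ^ 2) : XnormM s b k M u ≤ R := by
  have h0 : ∀ q : ℝ × ℝ, 0 ≤ wgt s b q.1 q.2 * ‖convFT k M u q.1 q.2‖ ^ 2 := fun q =>
    mul_nonneg (wgt_nonneg _ _ _ _) (sq_nonneg _)
  rw [XnormM, Real.sqrt_le_left hR, ← ENNReal.ofReal_le_ofReal_iff (sq_nonneg R),
    ENNReal.ofReal_pow hR]
  refine le_trans ?_ h
  rw [← Real.enorm_of_nonneg (integral_nonneg h0)]
  refine (enorm_integral_le_lintegral_enorm _).trans (le_of_eq (lintegral_congr fun q => ?_))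
  rw [Real.enorm_of_nonneg (h0 q), ENNReal.ofReal_mul (wgt_nonneg _ _ _ _),
    ENNReal.ofReal_pow (norm_nonneg _), ofReal_norm]

theorem enorm_convFT_le (n : ℕ) {K : ℝ} {M : (Fin (n + 1) → ℝ) → ℝ} (hM : ∀ ξ, 0 ≤ M ξ)
    (u : Fin (n + 1) → ℝ × ℝ → ℂ) (τ ξ : ℝ) :
    ‖convFT (n + 1) (fun ξ => if K < |PhiK (n + 1) ξ| then
        ((M ξ / |PhiK (n + 1) ξ| : ℝ) : ℂ) else 0) u τ ξ‖ₑ ≤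
      ∫⁻ p : Fin n → ℝ × ℝ, ENNReal.ofReal (M (padTot (n + 1) ξ fun i => (p i).2) *
          invKernel K (PhiK (n + 1) (padTot (n + 1) ξ fun i => (p i).2))) *
        ∏ j, ‖FT2 (u j) (padTot (n + 1) τ (fun i => (p i).1) j)
          (padTot (n + 1) ξ (fun i => (p i).2) j)‖ₑ := by
  refine (enorm_integral_le_lintegral_enorm _).trans (le_of_eq (lintegral_congr fun p => ?_))
  rw [enorm_mul, ← ofReal_norm (∏ j, _), norm_prod,
    ENNReal.ofReal_prod_of_nonneg fun j _ => norm_nonneg _]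
  simp only [ofReal_norm, invKernel]
  congr 1
  split_ifs with h
  · rw [← ofReal_norm, Complex.norm_real, Real.norm_of_nonneg (div_nonneg (hM _) (abs_nonneg _)),
      div_eq_mul_inv]
  · simp

theorem lintegral_rpow_one_add_sq_lt_top {γ : ℝ} (hγ : 1 / 2 < γ) :
    ∫⁻ t : ℝ, ENNReal.ofReal ((1 + t ^ 2) ^ (-γ)) < ⊤ := by
  have h := integrable_rpow_neg_one_add_norm_sq (E := ℝ) (μ := volume) (r := 2 * γ)
    (by simp; linarith)
  have := h.lintegral_lt_top
  simpa [neg_div] using this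

theorem exists_XnormM_le (n : ℕ) (s : ℝ) (sv : Fin (n + 1) → ℝ) {M M' M'' : (Fin (n + 1) → ℝ) → ℝ}
    (hM : Measurable M) (hM0 : ∀ ξ, 0 ≤ M ξ) {B : Finset (Fin (n + 2))}
    (hi : (1 : Fin (n + 2)) ∉ B) (hB : B.Nonempty) (hM' : Measurable M') (hM'' : Measurable M'')
    (hM'0 : ∀ ξ, 0 ≤ M' ξ) (hM''0 : ∀ ξ, 0 ≤ M'' ξ) {C₀ θ β b : ℝ} (hC₀ : 0 < C₀) (hθ1 : θ < 1)
    (hQ : ∀ ξ, √(M' ξ * M'' ξ) =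
      M ξ * (1 + (∑ j, ξ j) ^ 2) ^ (s / 2) / ∏ j, (1 + (ξ j) ^ 2) ^ (sv j / 2))
    (hFR' : FreqRestricted (n + 1) M' B C₀ θ) (hFR'' : FreqRestricted (n + 1) M'' Bᶜ C₀ θ)
    (hβ : 0 < β) (hβ1 : β ≤ 1) (hβθ : 2 * β < θ) (hb : 1 / 2 < b - β) :
    ∃ C : ℝ, 0 < C ∧ ∀ K : ℝ, 0 < K → ∀ v : Fin (n + 1) → SchwartzMap (ℝ × ℝ) ℂ,
      XnormM s (-β) (n + 1) (fun ξ => if K < |PhiK (n + 1) ξ| then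
          ((M ξ / |PhiK (n + 1) ξ| : ℝ) : ℂ) else 0) (fun j => ⇑(v j)) ≤
        C * K ^ (-(1 - θ)) * Xnorm (sv 0) (-β) ⇑(v 0) *
          ∏ j : Fin n, Xnorm (sv j.succ) b ⇑(v j.succ) := by
  obtain ⟨C₁, hC₁, hres⟩ := lintegral_resKernel_le hC₀ hθ1 hβ hβθ
  have hWt := lintegral_rpow_one_add_sq_lt_top hb
  set W := ∫⁻ t : ℝ, ENNReal.ofReal ((1 + t ^ 2) ^ (-(b - β)))
  have hX0 : ∀ s b u, 0 ≤ Xnorm s b u := fun s b u => Real.sqrt_nonneg _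
  refine ⟨(2 ^ (n + 1)) ^ (β / 2) * (C₁ * (√W.toReal + 1) ^ n), by positivity, fun K hK v => ?_⟩
  have hP : 0 ≤ ∏ j : Fin n, Xnorm (sv j.succ) b ⇑(v j.succ) :=
    Finset.prod_nonneg fun j _ => hX0 _ _ _
  have hX := hX0 (sv 0) (-β) (v 0)
  refine XnormM_le (by positivity) ?_
  have hWr : W ^ (1 / 2 : ℝ) ≤ ENNReal.ofReal (√W.toReal + 1) := by
    rw [← ENNReal.ofReal_toReal hWt.ne, ofReal_rpow_half ENNReal.toReal_nonneg,
      ENNReal.ofReal_toReal hWt.ne]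
    exact ENNReal.ofReal_le_ofReal (by linarith)
  have key := lintegral_wgt_mul_sq_le n B hi hB hM' hM'' hM'0 hM''0 hM (b := b) (s := s) (K := K)
    (sv := sv) hβ hβ1 (D := ENNReal.ofReal (C₁ * K ^ (θ - 1)))
    (fun α j₀ hj₀ g => hFR'.lintegral_le hM'
      (f := fun x => ENNReal.ofReal (resKernel β K x (x - α)))
      (((measurable_resKernel β K).comp (f := fun x : ℝ => (x, x - α))
        (by fun_prop)).ennreal_ofReal)
      (fun ν hν => hres ν hν α K hK) j₀ hj₀ g)
    (fun j₀ hj₀ g => hFR''.lintegral_le hM''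
      (f := fun x => ENNReal.ofReal (invKernel K x)) (measurable_invKernel K).ennreal_ofReal
      (fun ν hν => (lintegral_mono fun x => ENNReal.ofReal_le_ofReal
        (invKernel_le_resKernel β K x (x - 0))).trans (hres ν hν 0 K hK)) j₀ hj₀ g)
    hQ (f := fun j q => ‖FT2 (v j) q.1 q.2‖ₑ)
    (fun j => (continuous_FT2 (v j)).measurable.enorm)
  refine (lintegral_mono fun q => ?_).trans (key.trans ?_)
  · gcongr
    exact enorm_convFT_le n hM0 _ q.1 q.2
  · gcongr
    simp only [lintegral_wgt_mul_FT2_rpow]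
    rw [← ENNReal.ofReal_prod_of_nonneg fun j _ => hX0 _ _ _]
    calc _ ≤ ENNReal.ofReal ((2 ^ (n + 1)) ^ (β / 2)) * (ENNReal.ofReal (C₁ * K ^ (θ - 1)) *
          ENNReal.ofReal (√W.toReal + 1) ^ n * (ENNReal.ofReal (Xnorm (sv 0) (-β) ⇑(v 0)) *
            ENNReal.ofReal (∏ j : Fin n, Xnorm (sv j.succ) b ⇑(v j.succ)))) := by gcongr
      _ = _ := by
          rw [← ENNReal.ofReal_pow (by positivity), ← ENNReal.ofReal_mul hX,
            ← ENNReal.ofReal_mul (by positivity), ← ENNReal.ofReal_mul (by positivity),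
            ← ENNReal.ofReal_mul (by positivity), neg_sub]
          congr 1
          ring

theorem freq_restricted_to_bourgain_high_resonance
    (k : ℕ) (hk : 2 ≤ k) (s : ℝ) (sv : Fin k → ℝ)
    (M : (Fin k → ℝ) → ℝ) (hMmeas : Measurable M) (hMpos : ∀ ξ, 0 ≤ M ξ)
    (hMpoly : ∃ (C' : ℝ) (p : ℕ), ∀ ξ, |M ξ| ≤ C' * (1 + ‖ξ‖) ^ p)
    (A : Finset (Fin (k + 1))) (hA : A.Nonempty) (hA' : A ≠ Finset.univ)
    (M₁ M₂ : (Fin k → ℝ) → ℝ) (hM₁meas : Measurable M₁) (hM₂meas : Measurable M₂)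
    (hM₁pos : ∀ ξ, 0 ≤ M₁ ξ) (hM₂pos : ∀ ξ, 0 ≤ M₂ ξ)
    (C₀ θ : ℝ) (hC₀ : 0 < C₀) (hθ : 0 < θ) (hθ1 : θ < 1)
    (hfact : ∀ ξ : Fin k → ℝ,
      Real.sqrt (M₁ ξ * M₂ ξ) =
        M ξ * (1 + (∑ j, ξ j) ^ 2) ^ (s / 2) / ∏ j, (1 + (ξ j) ^ 2) ^ (sv j / 2))
    (hFR₁ : FreqRestricted k M₁ A C₀ θ)
    (hFR₂ : FreqRestricted k M₂ Aᶜ C₀ θ) :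
    ∃ b b' ε C : ℝ, 1/2 < b ∧ b < 1 ∧ b - 1 < b' ∧ b' < 0 ∧ 0 < ε ∧ 0 < C ∧
      ∀ K : ℝ, 0 < K → ∀ v : Fin k → SchwartzMap (ℝ × ℝ) ℂ,
        XnormM s b' k
            (fun ξ => if K < |PhiK k ξ| then ((M ξ / |PhiK k ξ| : ℝ) : ℂ) else 0)
            (fun j => ⇑(v j)) ≤
          C * K ^ (-ε) * Xnorm (sv ⟨0, by omega⟩) b' ⇑(v ⟨0, by omega⟩) *
            ∏ j ∈ Finset.univ.erase (⟨0, by omega⟩ : Fin k), Xnorm (sv j) b ⇑(v j) := by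
  obtain ⟨n, rfl⟩ : ∃ n, k = n + 1 := ⟨k - 1, by omega⟩
  obtain ⟨B, M', M'', hi, hB, hM', hM'', hM'0, hM''0, hQ, hFR', hFR''⟩ :
      ∃ (B : Finset (Fin (n + 2))) (M' M'' : (Fin (n + 1) → ℝ) → ℝ), (1 : Fin (n + 2)) ∉ B ∧
        B.Nonempty ∧ Measurable M' ∧ Measurable M'' ∧ (∀ ξ, 0 ≤ M' ξ) ∧ (∀ ξ, 0 ≤ M'' ξ) ∧
        (∀ ξ, √(M' ξ * M'' ξ) =
          M ξ * (1 + (∑ j, ξ j) ^ 2) ^ (s / 2) / ∏ j, (1 + (ξ j) ^ 2) ^ (sv j / 2)) ∧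
        FreqRestricted (n + 1) M' B C₀ θ ∧ FreqRestricted (n + 1) M'' Bᶜ C₀ θ := by
    by_cases h : (1 : Fin (n + 2)) ∈ A
    · refine ⟨Aᶜ, M₂, M₁, by simpa using h, ?_, hM₂meas, hM₁meas, hM₂pos, hM₁pos,
        fun ξ => by rw [mul_comm, hfact], hFR₂, by rwa [compl_compl]⟩
      rwa [Finset.nonempty_iff_ne_empty, ne_eq, Finset.compl_eq_empty_iff]
    · exact ⟨A, M₁, M₂, h, hA, hM₁meas, hM₂meas, hM₁pos, hM₂pos, hfact, hFR₁, hFR₂⟩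
  obtain ⟨C, hC, hmain⟩ := exists_XnormM_le n s sv (β := θ / 8) (b := 3 / 4) hMmeas hMpos hi hB
    hM' hM'' hM'0 hM''0 hC₀ hθ1 hQ hFR' hFR'' (by linarith) (by linarith) (by linarith)
    (by linarith)
  refine ⟨3 / 4, -(θ / 8), 1 - θ, C, by norm_num, by norm_num, by linarith, by linarith,
    by linarith, hC, fun K hK v => (hmain K hK v).trans (le_of_eq ?_)⟩
  have h0 : (⟨0, by omega⟩ : Fin (n + 1)) = 0 := rfl
  rw [h0, Fin.univ_succ, Finset.erase_cons, Finset.prod_map]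
  rfl

end
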